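/- Let μ be a box-like self-affine measure satisfying the rectangular open set condition (ROSC). Then for every q ≥ 0, the lower and upper L^q-spectra of μ coincide and τ_μ(q) = γ(q). -/

import Mathlib

open MeasureTheory Filter Set

attribute [local instance] Classical.propDecidable

noncomputable section

/-- Data of a box-like planar self-affine IFS: each map is `S i = T i ∘ L i + t i`, where
`T i` is the diagonal contraction `diag (c i, d i)` with `c i, d i ∈ (0,1)` and `L i` is a
linear isometry of the plane preserving `[-1,1]²`, i.e. one of the eight symmetries of the
square, encoded by whether it swaps the two axes (`swap`) and by a sign on each coordinate. -/
structure IFSData (ι : Type) where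
  c : ι → ℝ
  d : ι → ℝ
  swap : ι → Bool
  sgn1 : ι → Bool
  sgn2 : ι → Bool
  t : ι → ℝ × ℝ

namespace IFSData

variable {ι : Type}

/-- The affine contraction `S i = T i ∘ L i + t i`. -/
def S (B : IFSData ι) (i : ι) (x : ℝ × ℝ) : ℝ × ℝ :=
  ((if B.sgn1 i then 1 else -1) * (B.c i * (if B.swap i then x.2 else x.1)) + (B.t i).1,
   (if B.sgn2 i then 1 else -1) * (B.d i * (if B.swap i then x.1 else x.2)) + (B.t i).2)

/-- `(b(i), h(i))`: base and height of the rectangle `S_i([0,1]²)` for a finite word `i`. -/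
def dims (B : IFSData ι) (l : List ι) : ℝ × ℝ :=
  l.foldr (fun i w =>
    (B.c i * (if B.swap i then w.2 else w.1), B.d i * (if B.swap i then w.1 else w.2))) (1, 1)

/-- `α₁(i)`: the larger singular value of the linear part of `S_i`. -/
def alpha1 (B : IFSData ι) (l : List ι) : ℝ := max (B.dims l).1 (B.dims l).2

/-- `α₂(i)`: the smaller singular value of the linear part of `S_i`. -/
def alpha2 (B : IFSData ι) (l : List ι) : ℝ := min (B.dims l).1 (B.dims l).2

/-- Whether the composite map of the word maps horizontal lines to vertical lines. -/
def swapW (B : IFSData ι) (l : List ι) : Bool := l.foldr (fun i b => xor (B.swap i) b) false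

/-- The composite map `S_{i₁} ∘ ⋯ ∘ S_{i_k}` of a word. -/
def Sw (B : IFSData ι) (l : List ι) : ℝ × ℝ → ℝ × ℝ := l.foldr (fun i f => B.S i ∘ f) id

/-- The word `i` projects onto the first coordinate, i.e. `π_i = π₁`. -/
def usesPi1 (B : IFSData ι) (l : List ι) : Prop :=
  (B.swapW l = false ∧ (B.dims l).2 ≤ (B.dims l).1) ∨
    (B.swapW l = true ∧ (B.dims l).1 < (B.dims l).2)

/-- The projection `π_i` onto the direction of the longest side of `S_i([0,1]²)`. -/
def projW (B : IFSData ι) (l : List ι) : ℝ × ℝ → ℝ :=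
  if B.usesPi1 l then Prod.fst else Prod.snd

/-- The rectangular open set condition. -/
def ROSC (B : IFSData ι) : Prop :=
  ∃ x₁ x₂ y₁ y₂ : ℝ, x₁ < x₂ ∧ y₁ < y₂ ∧
    (∀ i, B.S i '' (Set.Ioo x₁ x₂ ×ˢ Set.Ioo y₁ y₂) ⊆ Set.Ioo x₁ x₂ ×ˢ Set.Ioo y₁ y₂) ∧
    Pairwise fun i j =>
      Disjoint (B.S i '' (Set.Ioo x₁ x₂ ×ˢ Set.Ioo y₁ y₂))
        (B.S j '' (Set.Ioo x₁ x₂ ×ˢ Set.Ioo y₁ y₂))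

end IFSData

/-- `p(i)`: the probability of a finite word. -/
def wordProb {ι : Type} (p : ι → ℝ) (l : List ι) : ℝ := (l.map p).prod

/-- `τ_i(q)`: the value of the `L^q`-spectrum of the projection `π_i μ`. -/
def tauW {ι : Type} (B : IFSData ι) (τ1 τ2 : ℝ → ℝ) (l : List ι) (q : ℝ) : ℝ :=
  if B.usesPi1 l then τ1 q else τ2 q

/-- The `q`-modified singular value function `ψ^{s,q}`. -/
def psiSV {ι : Type} (B : IFSData ι) (p : ι → ℝ) (τ1 τ2 : ℝ → ℝ) (s q : ℝ) (l : List ι) : ℝ :=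
  wordProb p l ^ q * B.alpha1 l ^ tauW B τ1 τ2 l q * B.alpha2 l ^ (s - tauW B τ1 τ2 l q)

/-- `Ψ_k^{s,q} = ∑_{i ∈ I^k} ψ^{s,q}(i)`. -/
def PsiSV {ι : Type} [Fintype ι] (B : IFSData ι) (p : ι → ℝ) (τ1 τ2 : ℝ → ℝ)
    (k : ℕ) (s q : ℝ) : ℝ :=
  ∑ f : Fin k → ι, psiSV B p τ1 τ2 s q (List.ofFn f)

/-- The lower `L^q`-spectrum of a measure. -/
def lowerLq {X : Type*} [MeasurableSpace X] [PseudoMetricSpace X] (ν : Measure X) (q : ℝ) : ℝ :=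
  liminf (fun δ : ℝ =>
      Real.log (∫ x, (ν (Metric.ball x δ)).toReal ^ (q - 1) ∂ν) / (-Real.log δ))
    (nhdsWithin 0 (Set.Ioi 0))

/-- The upper `L^q`-spectrum of a measure. -/
def upperLq {X : Type*} [MeasurableSpace X] [PseudoMetricSpace X] (ν : Measure X) (q : ℝ) : ℝ :=
  limsup (fun δ : ℝ =>
      Real.log (∫ x, (ν (Metric.ball x δ)).toReal ^ (q - 1) ∂ν) / (-Real.log δ))
    (nhdsWithin 0 (Set.Ioi 0))

/-- The `L^q`-spectrum of `ν` exists and equals `t`. -/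
def IsLqSpec {X : Type*} [MeasurableSpace X] [PseudoMetricSpace X]
    (ν : Measure X) (q t : ℝ) : Prop :=
  lowerLq ν q = t ∧ upperLq ν q = t

/-- `α_min = min_{i ∈ I} α₂(i)`. -/
def alphaMin {ι : Type} [Fintype ι] [Nonempty ι] (B : IFSData ι) : ℝ :=
  Finset.univ.inf' Finset.univ_nonempty fun i => min (B.c i) (B.d i)

/-- `α_max = max_{i ∈ I} α₁(i)`. -/
def alphaMax {ι : Type} [Fintype ι] [Nonempty ι] (B : IFSData ι) : ℝ :=
  Finset.univ.sup' Finset.univ_nonempty fun i => max (B.c i) (B.d i)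

/-- `p_max = max_{i ∈ I} p_i`. -/
def pMax {ι : Type} [Fintype ι] [Nonempty ι] (p : ι → ℝ) : ℝ :=
  Finset.univ.sup' Finset.univ_nonempty p

/-- The `δ`-stopping `I_δ`. -/
def stopping {ι : Type} (B : IFSData ι) (δ : ℝ) : Set (List ι) :=
  {l | l ≠ [] ∧ B.alpha2 l < δ ∧ δ ≤ B.alpha2 l.dropLast}


/-- The moment function `x ↦ x ^ q` vanishing at zero, also for `q = 0`. -/
def GG (q : ℝ) (x : ENNReal) : ENNReal := x * x ^ (q - 1)

lemma rpow_anti_of_nonpos {x y : ENNReal} {z : ℝ} (hz : z ≤ 0) (h : x ≤ y) : y ^ z ≤ x ^ z := by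
  have e : ∀ t : ENNReal, t ^ z = (t ^ (-z))⁻¹ := fun t => by rw [← ENNReal.rpow_neg, neg_neg]
  rw [e x, e y]
  exact ENNReal.inv_le_inv.mpr (ENNReal.rpow_le_rpow h (by linarith))

lemma GG_zero (q : ℝ) : GG q 0 = 0 := by simp [GG]

lemma GG_eq {q : ℝ} {x : ENNReal} (h0 : x ≠ 0) (ht : x ≠ ⊤) : GG q x = x ^ q := by
  unfold GG
  conv_lhs => rw [← ENNReal.rpow_one x]
  rw [← ENNReal.rpow_mul, ← ENNReal.rpow_add _ _ h0 ht]
  congr 1; ring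

lemma GG_one (q : ℝ) : GG q 1 = 1 := by simp [GG]

lemma GG_ne_top {q : ℝ} {x : ENNReal} (ht : x ≠ ⊤) : GG q x ≠ ⊤ := by
  by_cases h0 : x = 0
  · simp [h0, GG_zero]
  · rw [GG_eq h0 ht]; exact ENNReal.rpow_ne_top_of_ne_zero h0 ht

lemma GG_mono {q : ℝ} (hq : 0 ≤ q) {x y : ENNReal} (h : x ≤ y) (hy : y ≠ ⊤) :
    GG q x ≤ GG q y := by
  by_cases h0 : x = 0
  · simp [h0, GG_zero]
  · have hy0 : y ≠ 0 := fun h' => h0 (le_antisymm (h'  ▸ h) (zero_le))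
    rw [GG_eq h0 (ne_top_of_le_ne_top hy h), GG_eq hy0 hy]
    exact ENNReal.rpow_le_rpow h hq

lemma GG_mul {q : ℝ} {x y : ENNReal} (hx : x ≠ ⊤) (hy : y ≠ ⊤) :
    GG q (x * y) = GG q x * GG q y := by
  unfold GG
  rw [ENNReal.mul_rpow_of_ne_top hx hy]
  ring

lemma GG_sum {β : Type*} {q : ℝ} (hq : 0 ≤ q) (s : Finset β) (x : β → ENNReal)
    (hfin : ∑ i ∈ s, x i ≠ ⊤) :
    GG q (∑ i ∈ s, x i) ≤ (s.card : ENNReal) ^ q * ∑ i ∈ s, GG q (x i) := by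
  rcases s.eq_empty_or_nonempty with rfl | hs
  · simp [GG_zero]
  · obtain ⟨j, hj, hmax⟩ := s.exists_max_image x hs
    have hxj : x j ≠ ⊤ := ne_top_of_le_ne_top hfin (Finset.single_le_sum (fun _ _ => zero_le) hj)
    have h1 : ∑ i ∈ s, x i ≤ (s.card : ENNReal) * x j := by
      calc ∑ i ∈ s, x i ≤ ∑ i ∈ s, x j := Finset.sum_le_sum hmax
        _ = _ := by simp
    have hc : (s.card : ENNReal) ≠ ⊤ := ENNReal.natCast_ne_top _
    have hc0 : (s.card : ENNReal) ≠ 0 := by simpa using hs.ne_empty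
    calc GG q (∑ i ∈ s, x i) ≤ GG q ((s.card : ENNReal) * x j) :=
          GG_mono hq h1 (ENNReal.mul_ne_top hc hxj)
      _ = (s.card : ENNReal) ^ q * GG q (x j) := by rw [GG_mul hc hxj, GG_eq hc0 hc]
      _ ≤ _ := by
        gcongr
        exact Finset.single_le_sum (f := fun i => GG q (x i)) (fun _ _ => zero_le) hj

/-- Combinatorial comparison of moment sums for two partitions. -/
lemma CL {A B : Type*} (w : A → B → ENNReal) {q : ℝ} (hq : 0 ≤ q) (M M' : ℕ)
    (hfin : ∀ a, ∑' b, w a b ≠ ⊤) (hfin' : ∀ b, ∑' a, w a b ≠ ⊤)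
    (h1 : ∀ a, ∃ s : Finset B, s.card ≤ M ∧ ∀ b ∉ s, w a b = 0)
    (h2 : ∀ b, ∃ s : Finset A, s.card ≤ M' ∧ ∀ a ∉ s, w a b = 0) :
    ∑' a, GG q (∑' b, w a b) ≤ (M : ENNReal) ^ q * M' * ∑' b, GG q (∑' a, w a b) := by
  have e1 : ∀ a, GG q (∑' b, w a b) ≤ (M : ENNReal) ^ q * ∑' b, GG q (w a b) := by
    intro a
    obtain ⟨s, hs, hz⟩ := h1 a
    have hsum : ∑' b, w a b = ∑ b ∈ s, w a b := tsum_eq_sum hz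
    rw [hsum]
    refine (GG_sum hq s _ (hsum ▸ hfin a)).trans ?_
    gcongr
    exact ENNReal.sum_le_tsum s
  have e2 : ∀ b, ∑' a, GG q (w a b) ≤ M' * GG q (∑' a, w a b) := by
    intro b
    obtain ⟨s, hs, hz⟩ := h2 b
    rw [tsum_eq_sum (s := s) (fun a ha => by rw [hz a ha, GG_zero])]
    calc ∑ a ∈ s, GG q (w a b) ≤ ∑ a ∈ s, GG q (∑' a, w a b) :=
          Finset.sum_le_sum fun a _ => GG_mono hq (ENNReal.le_tsum a) (hfin' b)
      _ = s.card * GG q (∑' a, w a b) := by simp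
      _ ≤ _ := by gcongr
  calc ∑' a, GG q (∑' b, w a b) ≤ ∑' a, (M : ENNReal) ^ q * ∑' b, GG q (w a b) :=
        ENNReal.tsum_le_tsum e1
    _ = (M : ENNReal) ^ q * ∑' b, ∑' a, GG q (w a b) := by
        rw [ENNReal.tsum_mul_left, ENNReal.tsum_comm]
    _ ≤ (M : ENNReal) ^ q * ∑' b, M' * GG q (∑' a, w a b) := by
        gcongr with b; exact e2 b
    _ = _ := by rw [ENNReal.tsum_mul_left, mul_assoc]

/-- The moment sum of `ν` with respect to the partition into fibres of `f`. -/
def DD {X A : Type*} [MeasurableSpace X] (ν : Measure X) (f : X → A) (q : ℝ) : ENNReal :=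
  ∑' a, GG q (ν (f ⁻¹' {a}))

/-- The moment integral with balls. -/
def JJ {X : Type*} [MeasurableSpace X] [PseudoMetricSpace X] (ν : Measure X) (q δ : ℝ) : ENNReal :=
  ∫⁻ x, ν (Metric.ball x δ) ^ (q - 1) ∂ν

lemma meas_fibre_sum {X A : Type*} [MeasurableSpace X] [Countable A] (ν : Measure X)
    (f : X → A) (hf : ∀ a, MeasurableSet (f ⁻¹' {a})) (E : Set X) :
    ν E = ∑' a, ν (E ∩ f ⁻¹' {a}) := by
  have h : E = ⋃ a, E ∩ f ⁻¹' {a} := by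
    ext x; simp
  rw [← Measure.restrict_apply_univ, show (univ : Set X) = ⋃ a, f ⁻¹' {a} by ext x; simp,
    measure_iUnion _ hf]
  · congr 1; ext a; rw [Measure.restrict_apply (hf a), inter_comm]
  · intro a b hab
    refine Set.disjoint_left.mpr fun x hx hx' => hab ?_
    simp at hx hx'; rw [← hx, ← hx']

lemma DD_comp {X A B : Type*} [MeasurableSpace X] [Countable A] [Countable B] (ν : Measure X)
    [IsFiniteMeasure ν] (f : X → A) (g : X → B)
    (hf : ∀ a, MeasurableSet (f ⁻¹' {a})) (hg : ∀ b, MeasurableSet (g ⁻¹' {b}))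
    (E : Set X) (hE : ν Eᶜ = 0) {q : ℝ} (hq : 0 ≤ q) (M M' : ℕ)
    (h1 : ∀ a, ∃ s : Finset B, s.card ≤ M ∧ ∀ x ∈ E, f x = a → g x ∈ s)
    (h2 : ∀ b, ∃ s : Finset A, s.card ≤ M' ∧ ∀ x ∈ E, g x = b → f x ∈ s) :
    DD ν f q ≤ (M : ENNReal) ^ q * M' * DD ν g q := by
  have k1 : ∀ a, ν (f ⁻¹' {a}) = ∑' b, ν (f ⁻¹' {a} ∩ g ⁻¹' {b}) :=
    fun a => meas_fibre_sum ν g hg _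
  have k2 : ∀ b, ν (g ⁻¹' {b}) = ∑' a, ν (f ⁻¹' {a} ∩ g ⁻¹' {b}) := by
    intro b
    rw [meas_fibre_sum ν f hf]
    congr 1; ext a; rw [inter_comm]
  have hz : ∀ a b, (∀ x ∈ E, ¬ (f x = a ∧ g x = b)) → ν (f ⁻¹' {a} ∩ g ⁻¹' {b}) = 0 := by
    intro a b h
    refine measure_mono_null (fun x hx hxE => h x hxE ?_) hE
    exact hx
  unfold DD
  simp_rw [k1, k2]
  refine CL _ hq M M' (fun a => ?_) (fun b => ?_) (fun a => ?_) (fun b => ?_)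
  · rw [← k1]; exact measure_ne_top _ _
  · rw [← k2]; exact measure_ne_top _ _
  · obtain ⟨s, hs, h⟩ := h1 a
    exact ⟨s, hs, fun b hb => hz a b fun x hx hh => hb (hh.2 ▸ h x hx hh.1)⟩
  · obtain ⟨s, hs, h⟩ := h2 b
    exact ⟨s, hs, fun a ha => hz a b fun x hx hh => ha (hh.1 ▸ h x hx hh.2)⟩

lemma lintegral_fibre {X A : Type*} [MeasurableSpace X] [Countable A] (ν : Measure X)
    (f : X → A) (hf : ∀ a, MeasurableSet (f ⁻¹' {a})) (h : X → ENNReal) :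
    ∫⁻ x, h x ∂ν = ∑' a, ∫⁻ x in f ⁻¹' {a}, h x ∂ν := by
  rw [← lintegral_iUnion hf]
  · rw [show (⋃ a, f ⁻¹' {a}) = (univ : Set X) by ext x; simp]; simp
  · intro a b hab
    refine Set.disjoint_left.mpr fun x hx hx' => hab ?_
    simp at hx hx'; rw [← hx, ← hx']


lemma D_le_J_of_one_le {X A : Type*} [MeasurableSpace X] [PseudoMetricSpace X] [BorelSpace X]
    [SecondCountableTopology X] [Countable A] (ν : Measure X) [IsProbabilityMeasure ν]
    (f : X → A) {δ : ℝ}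
    (hf : ∀ a, MeasurableSet (f ⁻¹' {a}))
    (H1 : ∀ x y, f x = f y → dist x y < δ)
    {q : ℝ} (hq : 1 ≤ q) : DD ν f q ≤ JJ ν q δ := by
  unfold DD JJ
  rw [lintegral_fibre ν f hf]
  refine ENNReal.tsum_le_tsum fun a => ?_
  calc GG q (ν (f ⁻¹' {a})) = ∫⁻ x in f ⁻¹' {a}, ν (f ⁻¹' {a}) ^ (q - 1) ∂ν := by
        rw [setLIntegral_const, GG, mul_comm]
    _ ≤ _ := by
        refine setLIntegral_mono' (hf a) fun x hx => ?_
        refine ENNReal.rpow_le_rpow (measure_mono fun y hy => ?_) (by linarith)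
        rw [Metric.mem_ball]
        exact H1 y x (by simp at hx hy; rw [hx, hy])

lemma J_le_D_of_lt_one {X A : Type*} [MeasurableSpace X] [PseudoMetricSpace X] [BorelSpace X]
    [SecondCountableTopology X] [Countable A] (ν : Measure X) [IsProbabilityMeasure ν]
    (f : X → A) {δ : ℝ}
    (hf : ∀ a, MeasurableSet (f ⁻¹' {a}))
    (H1 : ∀ x y, f x = f y → dist x y < δ)
    {q : ℝ} (hq : q < 1) : JJ ν q δ ≤ DD ν f q := by
  unfold DD JJ
  rw [lintegral_fibre ν f hf]
  refine ENNReal.tsum_le_tsum fun a => ?_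
  calc _ ≤ ∫⁻ x in f ⁻¹' {a}, ν (f ⁻¹' {a}) ^ (q - 1) ∂ν := by
        refine setLIntegral_mono' (hf a) fun x hx => ?_
        refine rpow_anti_of_nonpos (by linarith) (measure_mono fun y hy => ?_) 
        rw [Metric.mem_ball]
        exact H1 y x (by simp at hx hy; rw [hx, hy])
    _ = _ := by
        rw [setLIntegral_const, GG, mul_comm]

lemma J_le_D_of_one_le {X A : Type*} [MeasurableSpace X] [PseudoMetricSpace X] [BorelSpace X]
    [SecondCountableTopology X] [Countable A] (ν : Measure X) [IsProbabilityMeasure ν]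
    (f : X → A) {δ : ℝ}
    (N : ℕ → A → Finset A) (cN : ℕ → ℕ)
    (hf : ∀ a, MeasurableSet (f ⁻¹' {a}))
    (hδ : 0 < δ)
    (hsymm : ∀ k a b, b ∈ N k a → a ∈ N k b)
    (hcard : ∀ k a, (N k a).card ≤ cN k)
    (H2 : ∀ (k : ℕ) x y, dist x y < k * δ → f y ∈ N k (f x))
    {q : ℝ} (hq : 1 ≤ q) :
    JJ ν q δ ≤ (cN 1 : ENNReal) ^ q * cN 1 * DD ν f q := by
  unfold DD JJ
  rw [lintegral_fibre ν f hf]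
  have e1 : ∀ a, ∫⁻ x in f ⁻¹' {a}, ν (Metric.ball x δ) ^ (q - 1) ∂ν ≤
      (cN 1 : ENNReal) ^ q * ∑' b, if b ∈ N 1 a then GG q (ν (f ⁻¹' {b})) else 0 := by
    intro a
    rcases (f ⁻¹' {a}).eq_empty_or_nonempty with h | ⟨x₀, hx₀⟩
    · simp [h]
    set S : ENNReal := ∑ b ∈ N 1 a, ν (f ⁻¹' {b}) with hS
    have hSt : S ≠ ⊤ := by
      rw [hS]; exact ENNReal.sum_ne_top.mpr fun b _ => measure_ne_top _ _
    have haa : a ∈ N 1 a := by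
      have := H2 1 x₀ x₀ (by simpa using hδ)
      simp at hx₀
      rwa [hx₀] at this
    calc _ ≤ ∫⁻ x in f ⁻¹' {a}, S ^ (q - 1) ∂ν := by
          refine setLIntegral_mono' (hf a) fun x hx => ?_
          refine ENNReal.rpow_le_rpow ?_ (by linarith)
          have : Metric.ball x δ ⊆ ⋃ b ∈ N 1 a, f ⁻¹' {b} := by
            intro y hy
            have := H2 1 x y (by rw [dist_comm]; simpa using hy)
            simp at hx
            rw [hx] at this
            simpa using this
          exact (measure_mono this).trans (measure_biUnion_finset_le _ _)
      _ = ν (f ⁻¹' {a}) * S ^ (q - 1) := by rw [setLIntegral_const, mul_comm]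
      _ ≤ GG q S := by
          unfold GG; gcongr
          exact Finset.single_le_sum (f := fun b => ν (f ⁻¹' {b})) (fun _ _ => zero_le) haa
      _ ≤ ((N 1 a).card : ENNReal) ^ q * ∑ b ∈ N 1 a, GG q (ν (f ⁻¹' {b})) :=
          GG_sum (by linarith) _ _ hSt
      _ ≤ _ := by
          gcongr
          · exact hcard 1 a
          · rw [tsum_eq_sum (s := N 1 a) (fun b hb => by simp [hb])]
            exact Finset.sum_le_sum fun b hb => by simp [hb]
  refine (ENNReal.tsum_le_tsum e1).trans ?_
  rw [ENNReal.tsum_mul_left, ENNReal.tsum_comm, mul_assoc, ← ENNReal.tsum_mul_left (a := (cN 1 : ENNReal))]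
  gcongr with b
  rw [tsum_eq_sum (s := N 1 b) (fun a ha => by
    rw [if_neg]; exact fun h => ha (hsymm _ _ _ h))]
  calc _ ≤ ∑ a ∈ N 1 b, GG q (ν (f ⁻¹' {b})) := by
        refine Finset.sum_le_sum fun a _ => ?_
        split_ifs <;> simp
    _ = (N 1 b).card * GG q (ν (f ⁻¹' {b})) := by simp
    _ ≤ _ := by gcongr; exact hcard 1 b

lemma D_le_J_of_lt_one {X A : Type*} [MeasurableSpace X] [PseudoMetricSpace X] [BorelSpace X]
    [SecondCountableTopology X] [Countable A] (ν : Measure X) [IsProbabilityMeasure ν]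
    (f : X → A) {δ : ℝ}
    (N : ℕ → A → Finset A) (cN : ℕ → ℕ)
    (hf : ∀ a, MeasurableSet (f ⁻¹' {a}))
    (hδ : 0 < δ)
    (hsymm : ∀ k a b, b ∈ N k a → a ∈ N k b)
    (hcard : ∀ k a, (N k a).card ≤ cN k)
    (H1 : ∀ x y, f x = f y → dist x y < δ)
    (H2 : ∀ (k : ℕ) x y, dist x y < k * δ → f y ∈ N k (f x))
    {q : ℝ} (hq0 : 0 ≤ q) (hq : q < 1) (m : ℕ) (K : ENNReal) (hK1 : 1 ≤ K)
    (hKt : K ≠ ⊤)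
    (hlow : ∀ᵐ x ∂ν, 1 < K ^ m * ν (Metric.ball x δ)) :
    DD ν f q ≤ K * cN (m + 1) * JJ ν q δ := by
  -- pick a good point in each cell of positive mass
  have hpick : ∀ a, ∃ E : Set X, MeasurableSet E ∧
      (∀ x ∈ E, a ∈ N (m + 1) (f x)) ∧
      GG q (ν (f ⁻¹' {a})) ≤ K * ∫⁻ y in E, ν (Metric.ball y δ) ^ (q - 1) ∂ν := by
    intro a
    by_cases h0 : ν (f ⁻¹' {a}) = 0
    · exact ⟨∅, MeasurableSet.empty, by simp, by simp [h0, GG_zero]⟩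
    obtain ⟨x, hxa, hx⟩ : ∃ x ∈ f ⁻¹' {a}, 1 < K ^ m * ν (Metric.ball x δ) := by
      by_contra hcon
      push Not at hcon
      refine h0 (measure_mono_null (fun x hx => ?_) hlow)
      simpa using hcon x hx
    set u : ℕ → ENNReal := fun k => ν (Metric.ball x ((k + 1 : ℕ) * δ)) with hu
    have hu1 : ∀ k, u k ≤ 1 := fun k => prob_le_one
    have hu0 : 1 < K ^ m * u 0 := by simpa [hu] using hx
    obtain ⟨k, hk, hkk⟩ : ∃ k < m, u (k + 1) ≤ K * u k := by
      by_contra hcon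
      push Not at hcon
      have : ∀ k ≤ m, K ^ k * u 0 ≤ u k := by
        intro k
        induction k with
        | zero => simp
        | succ k ih =>
          intro hk
          calc K ^ (k + 1) * u 0 = K * (K ^ k * u 0) := by ring
            _ ≤ K * u k := by gcongr; exact ih (by omega)
            _ ≤ u (k + 1) := (hcon k (by omega)).le
      exact absurd (hu0.trans_le ((this m le_rfl).trans (hu1 m))) (lt_irrefl _)
    have huk : u 0 ≤ u k := measure_mono (Metric.ball_subset_ball (by
      gcongr; omega))
    have hu00 : u 0 ≠ 0 := by
      intro h; rw [h] at hu0; simp at hu0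
    have huk0 : u k ≠ 0 := fun h => hu00 (le_antisymm (h ▸ huk) (zero_le))
    have hukt : u k ≠ ⊤ := measure_ne_top _ _
    refine ⟨Metric.ball x ((k + 1 : ℕ) * δ), Metric.isOpen_ball.measurableSet, ?_, ?_⟩
    · intro y hy
      have := H2 (m + 1) y x (lt_of_lt_of_le (Metric.mem_ball.mp hy) (by gcongr))
      rwa [show f x = a from hxa] at this
    · have hbnd : u (k + 1) ^ (q - 1) * u k ≤
          ∫⁻ y in Metric.ball x ((k + 1 : ℕ) * δ), ν (Metric.ball y δ) ^ (q - 1) ∂ν := by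
        calc _ = ∫⁻ y in Metric.ball x ((k + 1 : ℕ) * δ), u (k + 1) ^ (q - 1) ∂ν := by
              rw [setLIntegral_const]
          _ ≤ _ := by
              refine setLIntegral_mono' Metric.isOpen_ball.measurableSet fun y hy => ?_
              refine rpow_anti_of_nonpos (by linarith) (measure_mono ?_)
              refine Metric.ball_subset_ball' ?_
              have := (Metric.mem_ball.mp hy).le
              push_cast at *
              linarith
      have hK0 : K ≠ 0 := by rintro rfl; simp at hK1
      calc GG q (ν (f ⁻¹' {a})) ≤ GG q (u k) := by
            refine GG_mono hq0 (le_trans (measure_mono fun y hy => ?_) huk) hukt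
            simp only [zero_add, Nat.cast_one, one_mul, Metric.mem_ball]
            exact H1 y x (by simp at hxa hy; rw [hxa, hy])
        _ = u k * u k ^ (q - 1) := rfl
        _ ≤ K * (u (k + 1) ^ (q - 1) * u k) := by
            have h1 : (K * u k) ^ (q - 1) ≤ u (k + 1) ^ (q - 1) :=
              rpow_anti_of_nonpos (by linarith) hkk
            have h2 : u k ^ (q - 1) ≤ K * (K * u k) ^ (q - 1) := by
              rw [ENNReal.mul_rpow_of_ne_top hKt hukt, ← mul_assoc]
              have : K * K ^ (q - 1) = K ^ q := GG_eq hK0 hKt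
              rw [this]
              exact le_mul_of_one_le_left (zero_le) (by simpa using ENNReal.rpow_le_rpow hK1 hq0)
            calc u k * u k ^ (q - 1) ≤ u k * (K * u (k + 1) ^ (q - 1)) := by
                  gcongr; exact h2.trans (by gcongr)
              _ = _ := by ring
        _ ≤ _ := by gcongr
  choose E hEm hEN hE using hpick
  have hmeas : Measurable fun x => ν (Metric.ball x δ) ^ (q - 1) := by
    refine Measurable.pow_const ?_ _
    have hs : MeasurableSet {z : X × X | dist z.2 z.1 < δ} :=
      (isOpen_lt (by fun_prop) (by fun_prop)).measurableSet
    exact measurable_measure_prodMk_left hs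
  unfold DD
  calc _ ≤ ∑' a, K * ∫⁻ y in E a, ν (Metric.ball y δ) ^ (q - 1) ∂ν := ENNReal.tsum_le_tsum hE
    _ = K * ∫⁻ y, ∑' a, (E a).indicator (fun y => ν (Metric.ball y δ) ^ (q - 1)) y ∂ν := by
        rw [ENNReal.tsum_mul_left, lintegral_tsum]
        · congr 2; ext a; rw [lintegral_indicator (hEm a)]
        · exact fun a => (hmeas.indicator (hEm a)).aemeasurable
    _ ≤ K * ∫⁻ y, cN (m + 1) * ν (Metric.ball y δ) ^ (q - 1) ∂ν := by
        gcongr with y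
        rw [tsum_eq_sum (s := N (m + 1) (f y)) (fun a ha => by
          rw [indicator_of_notMem]; exact fun h => ha (hEN a y h))]
        calc _ ≤ ∑ a ∈ N (m + 1) (f y), ν (Metric.ball y δ) ^ (q - 1) := by
              refine Finset.sum_le_sum fun a _ => indicator_le_self _ _ _
          _ = (N (m + 1) (f y)).card * ν (Metric.ball y δ) ^ (q - 1) := by simp
          _ ≤ _ := by gcongr; exact hcard _ _
    _ = _ := by rw [lintegral_const_mul _ hmeas, JJ, mul_assoc]



/-- `F δ = δ ^ (-t + o(1))` as `δ → 0+`. -/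
def EX (F : ℝ → ENNReal) (t : ℝ) : Prop :=
  ∀ ε > (0 : ℝ), ∃ C : ℝ, 0 < C ∧ ∀ᶠ δ in nhdsWithin (0 : ℝ) (Set.Ioi 0),
    ENNReal.ofReal (C⁻¹ * δ ^ (ε - t)) ≤ F δ ∧ F δ ≤ ENNReal.ofReal (C * δ ^ (-ε - t))

/-- `F` is bounded by `G` up to subpolynomial factors. -/
def SubLE (F G : ℝ → ENNReal) : Prop :=
  ∀ ε > (0 : ℝ), ∃ C : ℝ, 0 < C ∧ ∀ᶠ δ in nhdsWithin (0 : ℝ) (Set.Ioi 0),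
    F δ ≤ ENNReal.ofReal (C * δ ^ (-ε)) * G δ

lemma ofReal_div_le {a b : ℝ} {G : ENNReal} (hb : 0 < b)
    (h : ENNReal.ofReal a ≤ ENNReal.ofReal b * G) : ENNReal.ofReal (a / b) ≤ G := by
  rw [ENNReal.ofReal_div_of_pos hb]
  refine ENNReal.div_le_of_le_mul ?_
  rwa [mul_comm]

lemma small_pos : ∀ᶠ δ in nhdsWithin (0 : ℝ) (Set.Ioi 0), 0 < δ ∧ δ < 1 := by
  filter_upwards [Ioo_mem_nhdsGT (show (0 : ℝ) < 1 by norm_num)] with δ hδ using hδ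

lemma EX_congr {F G : ℝ → ENNReal} {t : ℝ} (h1 : SubLE F G) (h2 : SubLE G F) (hF : EX F t) :
    EX G t := by
  intro ε hε
  obtain ⟨C, hC, h⟩ := hF (ε / 2) (by linarith)
  obtain ⟨C1, hC1, h1⟩ := h1 (ε / 2) (by linarith)
  obtain ⟨C2, hC2, h2⟩ := h2 (ε / 2) (by linarith)
  refine ⟨C * (C1 + C2), by positivity, ?_⟩
  filter_upwards [h, h1, h2, small_pos] with δ h h1 h2 hδ
  obtain ⟨hδ0, hδ1⟩ := hδ
  constructor
  · have hx : 0 < C1 * δ ^ (-(ε/2)) := by positivity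
    have h3 := h.1.trans h1
    replace h3 := ofReal_div_le hx h3
    refine le_trans (ENNReal.ofReal_le_ofReal ?_) h3
    rw [le_div_iff₀ hx]
    calc (C * (C1 + C2))⁻¹ * δ ^ (ε - t) * (C1 * δ ^ (-(ε / 2)))
        = C⁻¹ * (C1 / (C1 + C2)) * (δ ^ (ε - t) * δ ^ (-(ε / 2))) := by field_simp
      _ = C⁻¹ * (C1 / (C1 + C2)) * δ ^ (ε / 2 - t) := by
          rw [← Real.rpow_add hδ0]; congr 2; ring
      _ ≤ C⁻¹ * 1 * δ ^ (ε / 2 - t) := by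
          gcongr
          rw [div_le_one (by positivity)]; linarith
      _ = _ := by ring
  · refine h2.trans ((mul_le_mul_right h.2 _).trans ?_)
    rw [← ENNReal.ofReal_mul (by positivity)]
    refine ENNReal.ofReal_le_ofReal ?_
    calc C2 * δ ^ (-(ε / 2)) * (C * δ ^ (-(ε / 2) - t))
        = C * C2 * (δ ^ (-(ε / 2)) * δ ^ (-(ε / 2) - t)) := by ring
      _ = C * C2 * δ ^ (-ε - t) := by
          rw [← Real.rpow_add hδ0]; congr 2; ring
      _ ≤ _ := by gcongr; linarith

lemma neglog_atTop : Tendsto (fun δ : ℝ => -Real.log δ) (nhdsWithin 0 (Set.Ioi 0)) atTop :=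
  tendsto_neg_atBot_atTop.comp Real.tendsto_log_nhdsGT_zero

lemma EX_tendsto {F : ℝ → ENNReal} {t : ℝ} (h : EX F t) :
    Tendsto (fun δ => Real.log (F δ).toReal / (-Real.log δ)) (nhdsWithin 0 (Set.Ioi 0))
      (nhds t) := by
  rw [Metric.tendsto_nhds]
  intro e he
  obtain ⟨C, hC, h⟩ := h (e / 2) (by linarith)
  have hl : ∀ᶠ δ in nhdsWithin (0 : ℝ) (Set.Ioi 0), |Real.log C| * (2 / e) < -Real.log δ :=
    neglog_atTop.eventually_gt_atTop _
  filter_upwards [h, hl, small_pos] with δ h hl hδ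
  obtain ⟨hδ0, hδ1⟩ := hδ
  have hL : 0 < -Real.log δ := by have := Real.log_neg hδ0 hδ1; linarith
  have hx1 : 0 < C⁻¹ * δ ^ (e / 2 - t) := by positivity
  have hx2 : 0 < C * δ ^ (-(e / 2) - t) := by positivity
  have ht : F δ ≠ ⊤ := ne_top_of_le_ne_top (by simp) h.2
  have l1 : C⁻¹ * δ ^ (e / 2 - t) ≤ (F δ).toReal := by
    have := ENNReal.toReal_mono ht h.1
    rwa [ENNReal.toReal_ofReal hx1.le] at this
  have l2 : (F δ).toReal ≤ C * δ ^ (-(e / 2) - t) := by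
    have := ENNReal.toReal_mono (by simp) h.2
    rwa [ENNReal.toReal_ofReal hx2.le] at this
  have hF : 0 < (F δ).toReal := hx1.trans_le l1
  have m1 := Real.log_le_log hx1 l1
  have m2 := Real.log_le_log hF l2
  rw [Real.log_mul (by positivity) (by positivity), Real.log_rpow hδ0, Real.log_inv] at m1
  rw [Real.log_mul (by positivity) (by positivity), Real.log_rpow hδ0] at m2
  have hCabs : |Real.log C| < (-Real.log δ) * (e / 2) := by
    have : |Real.log C| = |Real.log C| * (2 / e) * (e / 2) := by field_simp
    rw [this]; gcongr
  have := abs_lt.mp hCabs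
  rw [Real.dist_eq, abs_lt]
  constructor
  · rw [lt_sub_iff_add_lt, lt_div_iff₀ hL]; nlinarith
  · rw [sub_lt_iff_lt_add, div_lt_iff₀ hL]; nlinarith

lemma EX_of_tendsto {F : ℝ → ENNReal} {t : ℝ}
    (hF : ∀ᶠ δ in nhdsWithin (0 : ℝ) (Set.Ioi 0), F δ ≠ 0 ∧ F δ ≠ ⊤)
    (h : Tendsto (fun δ => Real.log (F δ).toReal / (-Real.log δ)) (nhdsWithin 0 (Set.Ioi 0))
      (nhds t)) : EX F t := by
  intro ε hε
  refine ⟨1, one_pos, ?_⟩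
  filter_upwards [hF, (Metric.tendsto_nhds.mp h) ε hε, small_pos] with δ hF h hδ
  obtain ⟨hδ0, hδ1⟩ := hδ
  have hL : 0 < -Real.log δ := by have := Real.log_neg hδ0 hδ1; linarith
  have hp : 0 < (F δ).toReal := ENNReal.toReal_pos hF.1 hF.2
  rw [Real.dist_eq, abs_lt, lt_sub_iff_add_lt, lt_div_iff₀ hL, sub_lt_iff_lt_add,
    div_lt_iff₀ hL] at h
  rw [← ENNReal.ofReal_toReal hF.2]
  constructor
  · refine ENNReal.ofReal_le_ofReal ?_
    rw [inv_one, one_mul, ← Real.log_le_log_iff (by positivity) hp, Real.log_rpow hδ0]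
    nlinarith [h.1]
  · refine ENNReal.ofReal_le_ofReal ?_
    rw [one_mul, ← Real.log_le_log_iff hp (by positivity), Real.log_rpow hδ0]
    nlinarith [h.2]

lemma EX_unique {F : ℝ → ENNReal} {t t' : ℝ} (h : EX F t) (hh : EX F t') : t = t' :=
  tendsto_nhds_unique (EX_tendsto h) (EX_tendsto hh)

def PolyB (F : ℝ → ENNReal) : Prop :=
  ∃ C A : ℝ, 0 < C ∧ ∀ᶠ δ in nhdsWithin (0 : ℝ) (Set.Ioi 0),
    ENNReal.ofReal (C⁻¹ * δ ^ A) ≤ F δ ∧ F δ ≤ ENNReal.ofReal (C * δ ^ (-A))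

lemma PolyB_congr {F G : ℝ → ENNReal} (h1 : SubLE F G) (h2 : SubLE G F) (hF : PolyB F) :
    PolyB G := by
  obtain ⟨C, A, hC, h⟩ := hF
  obtain ⟨C1, hC1, h1⟩ := h1 1 (by linarith)
  obtain ⟨C2, hC2, h2⟩ := h2 1 (by linarith)
  refine ⟨C * (C1 + C2), A + 1, by positivity, ?_⟩
  filter_upwards [h, h1, h2, small_pos] with δ h h1 h2 hδ
  obtain ⟨hδ0, hδ1⟩ := hδ
  constructor
  · have hx : 0 < C1 * δ ^ (-1 : ℝ) := by positivity
    have h3 := h.1.trans h1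
    replace h3 := ofReal_div_le hx h3
    refine le_trans (ENNReal.ofReal_le_ofReal ?_) h3
    rw [le_div_iff₀ hx]
    calc (C * (C1 + C2))⁻¹ * δ ^ (A + 1) * (C1 * δ ^ (-1 : ℝ))
        = C⁻¹ * (C1 / (C1 + C2)) * (δ ^ (A + 1) * δ ^ (-1 : ℝ)) := by field_simp
      _ = C⁻¹ * (C1 / (C1 + C2)) * δ ^ A := by
          rw [← Real.rpow_add hδ0]; congr 2; ring
      _ ≤ C⁻¹ * 1 * δ ^ A := by
          gcongr
          rw [div_le_one (by positivity)]; linarith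
      _ = _ := by ring
  · refine h2.trans ((mul_le_mul_right h.2 _).trans ?_)
    rw [← ENNReal.ofReal_mul (by positivity)]
    refine ENNReal.ofReal_le_ofReal ?_
    calc C2 * δ ^ (-1 : ℝ) * (C * δ ^ (-A))
        = C * C2 * (δ ^ (-1 : ℝ) * δ ^ (-A)) := by ring
      _ = C * C2 * δ ^ (-(A + 1)) := by
          rw [← Real.rpow_add hδ0]; congr 2; ring
      _ ≤ _ := by gcongr; linarith

lemma EX_of_liminf_limsup {F : ℝ → ENNReal} {t : ℝ} (hF : PolyB F)
    (h1 : liminf (fun δ => Real.log (F δ).toReal / (-Real.log δ)) (nhdsWithin 0 (Set.Ioi 0)) = t)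
    (h2 : limsup (fun δ => Real.log (F δ).toReal / (-Real.log δ)) (nhdsWithin 0 (Set.Ioi 0)) = t) :
    EX F t := by
  obtain ⟨C, A, hC, h⟩ := hF
  have hl : ∀ᶠ δ in nhdsWithin (0 : ℝ) (Set.Ioi 0), |Real.log C| < -Real.log δ :=
    neglog_atTop.eventually_gt_atTop _
  have key : ∀ᶠ δ in nhdsWithin (0 : ℝ) (Set.Ioi 0), (F δ ≠ 0 ∧ F δ ≠ ⊤) ∧
      -(A + 1) ≤ Real.log (F δ).toReal / (-Real.log δ) ∧
      Real.log (F δ).toReal / (-Real.log δ) ≤ A + 1 := by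
    filter_upwards [h, hl, small_pos] with δ h hl hδ
    obtain ⟨hδ0, hδ1⟩ := hδ
    have hL : 0 < -Real.log δ := by have := Real.log_neg hδ0 hδ1; linarith
    have hx1 : 0 < C⁻¹ * δ ^ A := by positivity
    have hx2 : 0 < C * δ ^ (-A) := by positivity
    have ht : F δ ≠ ⊤ := ne_top_of_le_ne_top (by simp) h.2
    have l1 : C⁻¹ * δ ^ A ≤ (F δ).toReal := by
      have := ENNReal.toReal_mono ht h.1
      rwa [ENNReal.toReal_ofReal hx1.le] at this
    have l2 : (F δ).toReal ≤ C * δ ^ (-A) := by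
      have := ENNReal.toReal_mono (by simp) h.2
      rwa [ENNReal.toReal_ofReal hx2.le] at this
    have hF : 0 < (F δ).toReal := hx1.trans_le l1
    have m1 := Real.log_le_log hx1 l1
    have m2 := Real.log_le_log hF l2
    rw [Real.log_mul (by positivity) (by positivity), Real.log_rpow hδ0, Real.log_inv] at m1
    rw [Real.log_mul (by positivity) (by positivity), Real.log_rpow hδ0] at m2
    have := abs_lt.mp hl
    refine ⟨⟨(ENNReal.toReal_pos_iff.mp hF).1.ne', ht⟩, ?_, ?_⟩
    · rw [le_div_iff₀ hL]; nlinarith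
    · rw [div_le_iff₀ hL]; nlinarith
  refine EX_of_tendsto (key.mono fun δ h => h.1) ?_
  refine tendsto_of_liminf_eq_limsup h1 h2 ?_ ?_
  · exact ⟨A + 1, by simpa using key.mono fun δ h => h.2.2⟩
  · exact ⟨-(A + 1), by simpa using key.mono fun δ h => h.2.1⟩

/-- Polynomial lower bound for the mass of balls. -/
def PolyLow {X : Type*} [MeasurableSpace X] [PseudoMetricSpace X] (ν : Measure X) : Prop :=
  ∃ c A : ℝ, 0 < c ∧ 0 < A ∧ ∀ δ, 0 < δ → δ < 1 →
    ∀ᵐ x ∂ν, ENNReal.ofReal (c * δ ^ A) ≤ ν (Metric.ball x δ)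

lemma integral_eq_JJ {X : Type*} [MeasurableSpace X] [PseudoMetricSpace X] [BorelSpace X]
    [SecondCountableTopology X] (ν : Measure X) [IsProbabilityMeasure ν]
    (hlow : PolyLow ν) (q : ℝ) {δ : ℝ} (h0 : 0 < δ) (h1 : δ < 1) :
    ∫ x, (ν (Metric.ball x δ)).toReal ^ (q - 1) ∂ν = (JJ ν q δ).toReal := by
  obtain ⟨c, A, hc, hA, hl⟩ := hlow
  have hmeas : Measurable fun x => ν (Metric.ball x δ) := by
    have hs : MeasurableSet {z : X × X | dist z.2 z.1 < δ} :=
      (isOpen_lt (by fun_prop) (by fun_prop)).measurableSet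
    exact measurable_measure_prodMk_left hs
  rw [integral_eq_lintegral_of_nonneg_ae]
  · unfold JJ
    congr 1
    refine lintegral_congr_ae ?_
    filter_upwards [hl δ h0 h1] with x hx
    have hpos : 0 < ν (Metric.ball x δ) := lt_of_lt_of_le (by
      rw [ENNReal.ofReal_pos]; positivity) hx
    have hp : 0 < (ν (Metric.ball x δ)).toReal := ENNReal.toReal_pos hpos.ne' (measure_ne_top _ _)
    rw [← ENNReal.ofReal_rpow_of_pos hp, ENNReal.ofReal_toReal (measure_ne_top _ _)]
  · exact Eventually.of_forall fun x => by positivity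
  · exact (hmeas.ennreal_toReal.pow_const _).aestronglyMeasurable

lemma spec_to_EX {X : Type*} [MeasurableSpace X] [PseudoMetricSpace X] [BorelSpace X]
    [SecondCountableTopology X] (ν : Measure X) [IsProbabilityMeasure ν]
    (hlow : PolyLow ν) {q t : ℝ} (hP : PolyB (JJ ν q)) (h : IsLqSpec ν q t) : EX (JJ ν q) t := by
  have e : (fun δ : ℝ =>
      Real.log (∫ x, (ν (Metric.ball x δ)).toReal ^ (q - 1) ∂ν) / (-Real.log δ)) =ᶠ[nhdsWithin 0 (Set.Ioi 0)] (fun δ => Real.log (JJ ν q δ).toReal / (-Real.log δ)) := by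
    filter_upwards [small_pos] with δ hδ
    rw [integral_eq_JJ ν hlow q hδ.1 hδ.2]
  refine EX_of_liminf_limsup hP ?_ ?_
  · rw [← h.1, lowerLq]; exact (liminf_congr e).symm
  · rw [← h.2, upperLq]; exact (limsup_congr e).symm

lemma EX_to_spec {X : Type*} [MeasurableSpace X] [PseudoMetricSpace X] [BorelSpace X]
    [SecondCountableTopology X] (ν : Measure X) [IsProbabilityMeasure ν]
    (hlow : PolyLow ν) {q t : ℝ} (h : EX (JJ ν q) t) : lowerLq ν q = t ∧ upperLq ν q = t := by
  have e : (fun δ : ℝ =>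
      Real.log (∫ x, (ν (Metric.ball x δ)).toReal ^ (q - 1) ∂ν) / (-Real.log δ)) =ᶠ[nhdsWithin 0 (Set.Ioi 0)] (fun δ => Real.log (JJ ν q δ).toReal / (-Real.log δ)) := by
    filter_upwards [small_pos] with δ hδ
    rw [integral_eq_JJ ν hlow q hδ.1 hδ.2]
  have ht := (EX_tendsto h).congr' e.symm
  exact ⟨ht.liminf_eq, ht.limsup_eq⟩

lemma JD_equiv {X A : Type*} [MeasurableSpace X] [PseudoMetricSpace X] [BorelSpace X]
    [SecondCountableTopology X] [Countable A] (ν : Measure X) [IsProbabilityMeasure ν]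
    (f : ℝ → X → A) (hf : ∀ δ a, MeasurableSet (f δ ⁻¹' {a}))
    (N : ℕ → A → Finset A) (cN : ℕ → ℕ) (hsymm : ∀ k a b, b ∈ N k a → a ∈ N k b)
    (hcard : ∀ k a, (N k a).card ≤ cN k)
    (H1 : ∀ δ, 0 < δ → ∀ x y, f δ x = f δ y → dist x y < δ)
    (H2 : ∀ δ, 0 < δ → ∀ (k : ℕ) x y, dist x y < k * δ → f δ y ∈ N k (f δ x))
    (hlow : PolyLow ν) {q : ℝ} (hq : 0 ≤ q) :
    SubLE (JJ ν q) (fun δ => DD ν (f δ) q) ∧ SubLE (fun δ => DD ν (f δ) q) (JJ ν q) := by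
  have aux : ∀ (F G : ℝ → ENNReal) (c : ENNReal), c ≠ ⊤ → (∀ δ, 0 < δ → F δ ≤ c * G δ) →
      SubLE F G := by
    intro F G c hc h ε hε
    refine ⟨c.toReal + 1, by positivity, ?_⟩
    filter_upwards [small_pos] with δ hδ
    refine (h δ hδ.1).trans ?_
    gcongr
    rw [← ENNReal.ofReal_toReal hc]
    refine ENNReal.ofReal_le_ofReal ?_
    have := Real.one_le_rpow_of_pos_of_le_one_of_nonpos hδ.1 hδ.2.le (show -ε ≤ 0 by linarith)
    have h0 : 0 ≤ c.toReal := by positivity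
    rw [ENNReal.toReal_ofReal h0]
    nlinarith
  rcases le_or_gt 1 q with h1 | h1
  · constructor
    · refine aux _ _ ((cN 1 : ENNReal) ^ q * cN 1) ?_ fun δ hδ => ?_
      · exact ENNReal.mul_ne_top (ENNReal.rpow_ne_top_of_nonneg hq (by simp)) (by simp)
      · exact J_le_D_of_one_le ν (f δ) N cN (hf δ) hδ hsymm hcard (H2 δ hδ) h1
    · refine aux _ _ 1 (by simp) fun δ hδ => ?_
      rw [one_mul]
      exact D_le_J_of_one_le ν (f δ) (hf δ) (H1 δ hδ) h1
  · constructor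
    · refine aux _ _ 1 (by simp) fun δ hδ => ?_
      rw [one_mul]
      exact J_le_D_of_lt_one ν (f δ) (hf δ) (H1 δ hδ) h1
    · intro ε hε
      obtain ⟨c, A', hc, hA, hl⟩ := hlow
      obtain ⟨m, hm⟩ := exists_nat_gt (A' / ε)
      have hm0 : 0 < m := by
        have : 0 < A' / ε := by positivity
        exact_mod_cast this.trans hm
      have hmA : A' < m * ε := by rwa [div_lt_iff₀ hε] at hm
      set C0 : ℝ := 2 / c + 1 with hC0
      have hC1 : 1 ≤ C0 := by rw [hC0]; have : 0 < 2 / c := by positivity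
                              linarith
      have hC2 : 1 < C0 * c := by rw [hC0]; field_simp; linarith
      refine ⟨C0 * cN (m + 1) + 1, by positivity, ?_⟩
      filter_upwards [small_pos] with δ hδ
      obtain ⟨hδ0, hδ1⟩ := hδ
      have hone : 1 ≤ δ ^ (-ε) :=
        Real.one_le_rpow_of_pos_of_le_one_of_nonpos hδ0 hδ1.le (by linarith)
      have hK : 1 ≤ C0 * δ ^ (-ε) := by nlinarith
      refine (D_le_J_of_lt_one ν (f δ) N cN (hf δ) hδ0 hsymm hcard (H1 δ hδ0) (H2 δ hδ0) hq h1 m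
        (ENNReal.ofReal (C0 * δ ^ (-ε))) (by simpa using hK) (by simp) ?_).trans ?_
      · filter_upwards [hl δ hδ0 hδ1] with x hx
        refine lt_of_lt_of_le ?_ (mul_le_mul_right hx _)
        rw [← ENNReal.ofReal_pow (by positivity), ← ENNReal.ofReal_mul (by positivity),
          ENNReal.one_lt_ofReal]
        calc 1 < C0 * c := hC2
          _ ≤ C0 ^ m * c * δ ^ (A' - m * ε) := by
              have i1 : C0 ≤ C0 ^ m := le_self_pow₀ hC1 hm0.ne'
              have i2 : 1 ≤ δ ^ (A' - m * ε) :=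
                Real.one_le_rpow_of_pos_of_le_one_of_nonpos hδ0 hδ1.le (by linarith)
              calc C0 * c = C0 * c * 1 := by ring
                _ ≤ _ := by gcongr
          _ = _ := by
              rw [mul_pow, ← Real.rpow_natCast (δ ^ (-ε)), ← Real.rpow_mul hδ0.le,
                show A' - m * ε = -ε * m + A' by ring, Real.rpow_add hδ0]
              ring
      · gcongr
        rw [← ENNReal.ofReal_natCast, ← ENNReal.ofReal_mul (by positivity)]
        refine ENNReal.ofReal_le_ofReal ?_
        nlinarith

/-- Bounds for the moment sum when only `M` cells are charged. -/
lemma DD_triv {X A : Type*} [MeasurableSpace X] [Countable A] (ν : Measure X)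
    [IsProbabilityMeasure ν] (f : X → A) (hf : ∀ a, MeasurableSet (f ⁻¹' {a}))
    (E : Set X) (hE : ν Eᶜ = 0) {q : ℝ} (hq : 0 ≤ q) (M : ℕ)
    (h : ∃ s : Finset A, s.card ≤ M ∧ ∀ x ∈ E, f x ∈ s) :
    DD ν f q ≤ M ∧ 1 ≤ (M : ENNReal) ^ q * DD ν f q := by
  obtain ⟨s, hs, hx⟩ := h
  have hu : DD ν (fun _ => ()) q = 1 := by
    unfold DD
    simp [GG_one]
  have hm : ∀ a : Unit, MeasurableSet ((fun _ : X => ()) ⁻¹' {a}) := fun a => by simp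
  constructor
  · have := DD_comp ν f (fun _ => ()) hf hm E hE hq 1 M (fun a => ⟨{()}, by simp⟩)
      (fun _ => ⟨s, hs, fun x hxE _ => hx x hxE⟩)
    simpa [hu] using this
  · have := DD_comp ν (fun _ => ()) f hm hf E hE hq M 1 
      (fun _ => ⟨s, hs, fun x hxE _ => hx x hxE⟩) (fun a => ⟨{()}, by simp⟩)
    simpa [hu] using this

section words
variable {ι : Type}

lemma dims_cons (B : IFSData ι) (i : ι) (l : List ι) : B.dims (i :: l) =
    (B.c i * (if B.swap i then (B.dims l).2 else (B.dims l).1),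
      B.d i * (if B.swap i then (B.dims l).1 else (B.dims l).2)) := rfl

lemma swapW_cons (B : IFSData ι) (i : ι) (l : List ι) :
    B.swapW (i :: l) = xor (B.swap i) (B.swapW l) := rfl

lemma Sw_cons (B : IFSData ι) (i : ι) (l : List ι) : B.Sw (i :: l) = B.S i ∘ B.Sw l := rfl

lemma dims_nil (B : IFSData ι) : B.dims [] = (1, 1) := rfl
lemma swapW_nil (B : IFSData ι) : B.swapW [] = false := rfl
lemma Sw_nil (B : IFSData ι) : B.Sw [] = id := rfl

lemma Sw_append (B : IFSData ι) (l l' : List ι) : B.Sw (l ++ l') = B.Sw l ∘ B.Sw l' := by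
  induction l with
  | nil => rfl
  | cons i l ih => rw [List.cons_append, Sw_cons, ih, Sw_cons]; rfl

lemma dims_append (B : IFSData ι) (l l' : List ι) : B.dims (l ++ l') =
    if B.swapW l then ((B.dims l).1 * (B.dims l').2, (B.dims l).2 * (B.dims l').1)
    else ((B.dims l).1 * (B.dims l').1, (B.dims l).2 * (B.dims l').2) := by
  induction l with
  | nil => simp [dims_nil, swapW_nil]
  | cons i l ih =>
    rw [List.cons_append, dims_cons, ih, dims_cons, swapW_cons]
    cases B.swap i <;> cases B.swapW l <;> simp [mul_assoc]

lemma wordProb_append (p : ι → ℝ) (l l' : List ι) :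
    wordProb p (l ++ l') = wordProb p l * wordProb p l' := by simp [wordProb]

lemma wordProb_pos {p : ι → ℝ} (hp : ∀ i, 0 < p i) (l : List ι) : 0 < wordProb p l := by
  unfold wordProb
  refine List.prod_pos ?_
  simp only [List.mem_map, forall_exists_index, and_imp, forall_apply_eq_imp_iff₂]
  exact fun i _ => hp i

lemma dims_pos {B : IFSData ι} (hc : ∀ i, 0 < B.c i) (hd : ∀ i, 0 < B.d i) (l : List ι) :
    0 < (B.dims l).1 ∧ 0 < (B.dims l).2 := by
  induction l with
  | nil => simp [dims_nil]
  | cons i l ih =>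
    rw [dims_cons]
    have := hc i
    have := hd i
    obtain ⟨h1, h2⟩ := ih
    cases B.swap i <;> simp <;> constructor <;> positivity

lemma dims_le_pow {B : IFSData ι} (hc : ∀ i, 0 < B.c i) (hd : ∀ i, 0 < B.d i) {M : ℝ}
    (hcM : ∀ i, B.c i ≤ M) (hdM : ∀ i, B.d i ≤ M) (l : List ι) :
    (B.dims l).1 ≤ M ^ l.length ∧ (B.dims l).2 ≤ M ^ l.length := by
  induction l with
  | nil => simp [dims_nil]
  | cons i l ih =>
    rw [dims_cons]
    have hM : 0 < M := (hc i).trans_le (hcM i)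
    obtain ⟨h1, h2⟩ := ih
    have := dims_pos hc hd l
    have := hcM i
    have := hdM i
    have := hc i
    have := hd i
    cases B.swap i <;> simp [pow_succ'] <;> constructor <;> gcongr <;> linarith

lemma pow_le_dims {B : IFSData ι} {m : ℝ} (hm : 0 < m)
    (hcm : ∀ i, m ≤ B.c i) (hdm : ∀ i, m ≤ B.d i) (l : List ι) :
    m ^ l.length ≤ (B.dims l).1 ∧ m ^ l.length ≤ (B.dims l).2 := by
  induction l with
  | nil => simp [dims_nil]
  | cons i l ih =>
    rw [dims_cons]
    obtain ⟨h1, h2⟩ := ih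
    have := hcm i
    have := hdm i
    have h : 0 < m ^ l.length := by positivity
    cases B.swap i <;> simp [pow_succ'] <;> constructor <;> gcongr <;> linarith

lemma alpha2_append_singleton {B : IFSData ι} {m : ℝ} (hm : 0 < m)
    (hcm : ∀ i, m ≤ B.c i) (hdm : ∀ i, m ≤ B.d i) (l : List ι) (i : ι) :
    m * B.alpha2 l ≤ B.alpha2 (l ++ [i]) := by
  have hp := dims_pos (fun i => hm.trans_le (hcm i)) (fun i => hm.trans_le (hdm i)) l
  have h2 := pow_le_dims hm hcm hdm [i]
  simp only [List.length_singleton, pow_one] at h2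
  unfold IFSData.alpha2
  rw [dims_append]
  have k1 : m * min (B.dims l).1 (B.dims l).2 ≤ (B.dims l).1 * m := by
    rw [mul_comm]; gcongr; exact min_le_left _ _
  have k2 : m * min (B.dims l).1 (B.dims l).2 ≤ (B.dims l).2 * m := by
    rw [mul_comm]; gcongr; exact min_le_right _ _
  cases B.swapW l <;> simp only [Bool.false_eq_true, if_false, if_true] <;> 
    refine le_min (k1.trans ?_) (k2.trans ?_) <;> gcongr
  exacts [hp.1.le, h2.1, hp.2.le, h2.2, hp.1.le, h2.2, hp.2.le, h2.1]

lemma Sw_form (B : IFSData ι) (l : List ι) : ∃ σ₁ σ₂ t₁ t₂ : ℝ, (σ₁ = 1 ∨ σ₁ = -1) ∧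
    (σ₂ = 1 ∨ σ₂ = -1) ∧ ∀ x : ℝ × ℝ, B.Sw l x =
      (σ₁ * ((B.dims l).1 * (if B.swapW l then x.2 else x.1)) + t₁,
       σ₂ * ((B.dims l).2 * (if B.swapW l then x.1 else x.2)) + t₂) := by
  induction l with
  | nil => exact ⟨1, 1, 0, 0, by simp, by simp, fun x => by simp [Sw_nil, dims_nil, swapW_nil]⟩
  | cons i l ih =>
    obtain ⟨σ₁, σ₂, t₁, t₂, h1, h2, hx⟩ := ih
    have hs1 : ((if B.sgn1 i then 1 else -1 : ℝ) = 1 ∨ (if B.sgn1 i then 1 else -1 : ℝ) = -1) := by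
      split_ifs <;> simp
    have hs2 : ((if B.sgn2 i then 1 else -1 : ℝ) = 1 ∨ (if B.sgn2 i then 1 else -1 : ℝ) = -1) := by
      split_ifs <;> simp
    have hmul : ∀ a b : ℝ, (a = 1 ∨ a = -1) → (b = 1 ∨ b = -1) → (a * b = 1 ∨ a * b = -1) := by
      rintro a b (rfl | rfl) (rfl | rfl) <;> simp
    cases hsw : B.swap i
    · refine ⟨_, _, (if B.sgn1 i then 1 else -1 : ℝ) * (B.c i * t₁) + (B.t i).1,
        (if B.sgn2 i then 1 else -1 : ℝ) * (B.d i * t₂) + (B.t i).2,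
        hmul _ _ hs1 h1, hmul _ _ hs2 h2, fun x => ?_⟩
      rw [Sw_cons, Function.comp, hx, dims_cons, swapW_cons, IFSData.S, hsw]
      cases B.sgn1 i <;> cases B.sgn2 i <;> cases B.swapW l <;> ext <;> simp <;> ring
    · refine ⟨_, _, (if B.sgn1 i then 1 else -1 : ℝ) * (B.c i * t₂) + (B.t i).1,
        (if B.sgn2 i then 1 else -1 : ℝ) * (B.d i * t₁) + (B.t i).2,
        hmul _ _ hs1 h2, hmul _ _ hs2 h1, fun x => ?_⟩
      rw [Sw_cons, Function.comp, hx, dims_cons, swapW_cons, IFSData.S, hsw]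
      cases B.sgn1 i <;> cases B.sgn2 i <;> cases B.swapW l <;> ext <;> simp <;> ring

/-- First branch of the singular value function. -/
def phi1 (B : IFSData ι) (p : ι → ℝ) (a s q : ℝ) (l : List ι) : ℝ :=
  wordProb p l ^ q * (B.dims l).1 ^ a * (B.dims l).2 ^ (s - a)

/-- Second branch of the singular value function. -/
def phi2 (B : IFSData ι) (p : ι → ℝ) (b s q : ℝ) (l : List ι) : ℝ :=
  wordProb p l ^ q * (B.dims l).2 ^ b * (B.dims l).1 ^ (s - b)

lemma phi1_pos {B : IFSData ι} (hc : ∀ i, 0 < B.c i) (hd : ∀ i, 0 < B.d i) {p : ι → ℝ}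
    (hp : ∀ i, 0 < p i) (a s q : ℝ) (l : List ι) : 0 < phi1 B p a s q l := by
  have := dims_pos hc hd l
  have h1 := this.1
  have h2 := this.2
  have := wordProb_pos hp l
  unfold phi1; positivity

lemma phi2_pos {B : IFSData ι} (hc : ∀ i, 0 < B.c i) (hd : ∀ i, 0 < B.d i) {p : ι → ℝ}
    (hp : ∀ i, 0 < p i) (a s q : ℝ) (l : List ι) : 0 < phi2 B p a s q l := by
  have := dims_pos hc hd l
  have h1 := this.1
  have h2 := this.2
  have := wordProb_pos hp l
  unfold phi2; positivity

lemma swapW_false {B : IFSData ι} (h : ∀ i, B.swap i = false) (l : List ι) :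
    B.swapW l = false := by
  induction l with
  | nil => rfl
  | cons i l ih => rw [swapW_cons, h, ih]; rfl

lemma psi_eq_ite {B : IFSData ι} {p : ι → ℝ} {τ1 τ2 : ℝ → ℝ} {q : ℝ}
    (HS : (∀ i, B.swap i = false) ∨ τ1 q = τ2 q) (s : ℝ) (l : List ι) :
    psiSV B p τ1 τ2 s q l = if (B.dims l).2 ≤ (B.dims l).1 then phi1 B p (τ1 q) s q l
      else phi2 B p (τ2 q) s q l := by
  have ht : tauW B τ1 τ2 l q = if (B.dims l).2 ≤ (B.dims l).1 then τ1 q else τ2 q := by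
    rcases HS with h | h
    · unfold tauW IFSData.usesPi1
      simp [swapW_false h l]
    · unfold tauW; simp [h]
  unfold psiSV phi1 phi2
  rw [ht]
  unfold IFSData.alpha1 IFSData.alpha2
  by_cases h : (B.dims l).2 ≤ (B.dims l).1
  · simp only [h, if_true, max_eq_left, min_eq_right]
  · have h' := (not_le.mp h).le
    simp only [h, if_false, max_eq_right h', min_eq_left h']

lemma phi_ratio {B : IFSData ι} (hc : ∀ i, 0 < B.c i) (hd : ∀ i, 0 < B.d i) {p : ι → ℝ}
    (a b s q : ℝ) (l : List ι) :
    phi1 B p a s q l = phi2 B p b s q l * ((B.dims l).1 / (B.dims l).2) ^ (a + b - s) := by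
  obtain ⟨h1, h2⟩ := dims_pos hc hd l
  unfold phi1 phi2
  rw [Real.div_rpow h1.le h2.le, show s - a = b - (a + b - s) by ring, Real.rpow_sub h2,
    show (a : ℝ) = (s - b) + (a + b - s) by ring, Real.rpow_add h1]
  rw [show s - b + (a + b - s) + b - s = a + b - s by ring]
  ring

lemma psi_max {B : IFSData ι} (hc : ∀ i, 0 < B.c i) (hd : ∀ i, 0 < B.d i)
    {p : ι → ℝ} (hp : ∀ i, 0 < p i) {τ1 τ2 : ℝ → ℝ} {q : ℝ}
    (HS : (∀ i, B.swap i = false) ∨ τ1 q = τ2 q) {s : ℝ} (hs : s ≤ τ1 q + τ2 q) (l : List ι) :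
    psiSV B p τ1 τ2 s q l = max (phi1 B p (τ1 q) s q l) (phi2 B p (τ2 q) s q l) := by
  rw [psi_eq_ite HS]
  obtain ⟨h1, h2⟩ := dims_pos hc hd l
  have h0 := (phi2_pos hc hd hp (τ2 q) s q l).le
  split_ifs with h
  · rw [max_eq_left]
    rw [phi_ratio hc hd (τ1 q) (τ2 q) s q l]
    refine le_mul_of_one_le_right h0 (Real.one_le_rpow ?_ (by linarith))
    rwa [one_le_div h2]
  · rw [max_eq_right]
    rw [phi_ratio hc hd (τ1 q) (τ2 q) s q l]
    refine mul_le_of_le_one_right h0 (Real.rpow_le_one (by positivity) ?_ (by linarith))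
    rw [div_le_one h2]; linarith

lemma psi_min {B : IFSData ι} (hc : ∀ i, 0 < B.c i) (hd : ∀ i, 0 < B.d i)
    {p : ι → ℝ} (hp : ∀ i, 0 < p i) {τ1 τ2 : ℝ → ℝ} {q : ℝ}
    (HS : (∀ i, B.swap i = false) ∨ τ1 q = τ2 q) {s : ℝ} (hs : τ1 q + τ2 q ≤ s) (l : List ι) :
    psiSV B p τ1 τ2 s q l = min (phi1 B p (τ1 q) s q l) (phi2 B p (τ2 q) s q l) := by
  rw [psi_eq_ite HS]
  obtain ⟨h1, h2⟩ := dims_pos hc hd l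
  have h0 := (phi2_pos hc hd hp (τ2 q) s q l).le
  split_ifs with h
  · rw [min_eq_left]
    rw [phi_ratio hc hd (τ1 q) (τ2 q) s q l]
    refine mul_le_of_le_one_right h0 (Real.rpow_le_one_of_one_le_of_nonpos ?_ (by linarith))
    rwa [one_le_div h2]
  · rw [min_eq_right]
    rw [phi_ratio hc hd (τ1 q) (τ2 q) s q l]
    refine le_mul_of_one_le_right h0
      (Real.one_le_rpow_of_pos_of_le_one_of_nonpos (by positivity) ?_ (by linarith))
    rw [div_le_one h2]; linarith

lemma phi1_append {B : IFSData ι} (hc : ∀ i, 0 < B.c i) (hd : ∀ i, 0 < B.d i)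
    {p : ι → ℝ} (hp : ∀ i, 0 < p i) {a b q : ℝ}
    (HS : (∀ i, B.swap i = false) ∨ a = b) (s : ℝ) (l l' : List ι) :
    phi1 B p a s q (l ++ l') = phi1 B p a s q l *
      (if B.swapW l then phi2 B p b s q l' else phi1 B p a s q l') := by
  obtain ⟨h1, h2⟩ := dims_pos hc hd l
  obtain ⟨h3, h4⟩ := dims_pos hc hd l'
  have k1 := wordProb_pos hp l
  have k2 := wordProb_pos hp l'
  have HS' : B.swapW l = false ∨ a = b := HS.imp (fun h => swapW_false h l) id
  unfold phi1 phi2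
  rw [dims_append, wordProb_append, Real.mul_rpow k1.le k2.le]
  cases hs : B.swapW l
  · simp only [Bool.false_eq_true, if_false]
    rw [Real.mul_rpow h1.le h3.le, Real.mul_rpow h2.le h4.le]
    ring
  · have hab : a = b := by simpa [hs] using HS'
    subst hab
    simp only [if_true]
    rw [Real.mul_rpow h1.le h4.le, Real.mul_rpow h2.le h3.le]
    ring

lemma phi2_append {B : IFSData ι} (hc : ∀ i, 0 < B.c i) (hd : ∀ i, 0 < B.d i)
    {p : ι → ℝ} (hp : ∀ i, 0 < p i) {a b q : ℝ}
    (HS : (∀ i, B.swap i = false) ∨ a = b) (s : ℝ) (l l' : List ι) :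
    phi2 B p b s q (l ++ l') = phi2 B p b s q l *
      (if B.swapW l then phi1 B p a s q l' else phi2 B p b s q l') := by
  obtain ⟨h1, h2⟩ := dims_pos hc hd l
  obtain ⟨h3, h4⟩ := dims_pos hc hd l'
  have k1 := wordProb_pos hp l
  have k2 := wordProb_pos hp l'
  have HS' : B.swapW l = false ∨ a = b := HS.imp (fun h => swapW_false h l) id
  unfold phi1 phi2
  rw [dims_append, wordProb_append, Real.mul_rpow k1.le k2.le]
  cases hs : B.swapW l
  · simp only [Bool.false_eq_true, if_false]
    rw [Real.mul_rpow h1.le h3.le, Real.mul_rpow h2.le h4.le]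
    ring
  · have hab : a = b := by simpa [hs] using HS'
    subst hab
    simp only [if_true]
    rw [Real.mul_rpow h1.le h4.le, Real.mul_rpow h2.le h3.le]
    ring

lemma psi_pos {B : IFSData ι} (hc : ∀ i, 0 < B.c i) (hd : ∀ i, 0 < B.d i)
    {p : ι → ℝ} (hp : ∀ i, 0 < p i) (τ1 τ2 : ℝ → ℝ) (s q : ℝ) (l : List ι) :
    0 < psiSV B p τ1 τ2 s q l := by
  obtain ⟨h1, h2⟩ := dims_pos hc hd l
  have k1 := wordProb_pos hp l
  have a1 : 0 < B.alpha1 l := lt_max_of_lt_left h1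
  have a2 : 0 < B.alpha2 l := lt_min h1 h2
  unfold psiSV; positivity

lemma psi_sub {B : IFSData ι} (hc : ∀ i, 0 < B.c i) (hd : ∀ i, 0 < B.d i)
    {p : ι → ℝ} (hp : ∀ i, 0 < p i) {τ1 τ2 : ℝ → ℝ} {q : ℝ}
    (HS : (∀ i, B.swap i = false) ∨ τ1 q = τ2 q) {s : ℝ} (hs : s ≤ τ1 q + τ2 q) (l l' : List ι) :
    psiSV B p τ1 τ2 s q (l ++ l') ≤ psiSV B p τ1 τ2 s q l * psiSV B p τ1 τ2 s q l' := by
  rw [psi_max hc hd hp HS hs (l ++ l')]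
  have e1 := psi_max hc hd hp HS hs l
  have e2 := psi_max hc hd hp HS hs l'
  have p1 := (phi1_pos hc hd hp (τ1 q) s q l').le
  have p2 := (phi2_pos hc hd hp (τ2 q) s q l').le
  have p3 := (psi_pos hc hd hp τ1 τ2 s q l).le
  refine max_le ?_ ?_
  · rw [phi1_append hc hd hp HS]
    refine mul_le_mul (e1 ▸ le_max_left _ _) ?_ (by split_ifs <;> assumption) p3
    rw [e2]; split_ifs
    exacts [le_max_right _ _, le_max_left _ _]
  · rw [phi2_append hc hd hp HS]
    refine mul_le_mul (e1 ▸ le_max_right _ _) ?_ (by split_ifs <;> assumption) p3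
    rw [e2]; split_ifs
    exacts [le_max_left _ _, le_max_right _ _]

lemma psi_super {B : IFSData ι} (hc : ∀ i, 0 < B.c i) (hd : ∀ i, 0 < B.d i)
    {p : ι → ℝ} (hp : ∀ i, 0 < p i) {τ1 τ2 : ℝ → ℝ} {q : ℝ}
    (HS : (∀ i, B.swap i = false) ∨ τ1 q = τ2 q) {s : ℝ} (hs : τ1 q + τ2 q ≤ s) (l l' : List ι) :
    psiSV B p τ1 τ2 s q l * psiSV B p τ1 τ2 s q l' ≤ psiSV B p τ1 τ2 s q (l ++ l') := by
  rw [psi_min hc hd hp HS hs (l ++ l')]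
  have e1 := psi_min hc hd hp HS hs l
  have e2 := psi_min hc hd hp HS hs l'
  have p1 := (phi1_pos hc hd hp (τ1 q) s q l).le
  have p2 := (phi2_pos hc hd hp (τ2 q) s q l).le
  have p3 := (psi_pos hc hd hp τ1 τ2 s q l').le
  refine le_min ?_ ?_
  · rw [phi1_append hc hd hp HS]
    refine mul_le_mul (e1 ▸ min_le_left _ _) ?_ p3 p1
    rw [e2]; split_ifs
    exacts [min_le_right _ _, min_le_left _ _]
  · rw [phi2_append hc hd hp HS]
    refine mul_le_mul (e1 ▸ min_le_right _ _) ?_ p3 p2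
    rw [e2]; split_ifs
    exacts [min_le_left _ _, min_le_right _ _]

lemma psi_ext {B : IFSData ι} (hc : ∀ i, 0 < B.c i) (hd : ∀ i, 0 < B.d i)
    {p : ι → ℝ} (hp : ∀ i, 0 < p i) {τ1 τ2 : ℝ → ℝ} {q : ℝ}
    (HS : (∀ i, B.swap i = false) ∨ τ1 q = τ2 q) {s : ℝ} (hs : τ1 q + τ2 q ≤ s) (l l' : List ι) :
    psiSV B p τ1 τ2 s q (l ++ l') ≤ psiSV B p τ1 τ2 s q l *
      max (phi1 B p (τ1 q) s q l') (phi2 B p (τ2 q) s q l') := by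
  rw [psi_min hc hd hp HS hs (l ++ l'), psi_min hc hd hp HS hs l]
  have p1 := (phi1_pos hc hd hp (τ1 q) s q l).le
  have p2 := (phi2_pos hc hd hp (τ2 q) s q l).le
  rw [phi1_append hc hd hp HS, phi2_append hc hd hp HS]
  rcases le_total (phi1 B p (τ1 q) s q l) (phi2 B p (τ2 q) s q l) with h | h
  · rw [min_eq_left h]
    refine (min_le_left _ _).trans (mul_le_mul_of_nonneg_left ?_ p1)
    split_ifs
    exacts [le_max_right _ _, le_max_left _ _]
  · rw [min_eq_right h]
    refine (min_le_right _ _).trans (mul_le_mul_of_nonneg_left ?_ p2)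
    split_ifs
    exacts [le_max_left _ _, le_max_right _ _]

end words

section trees
variable {ι : Type} [Fintype ι]

/-- Sum over the level `j` descendants. -/
def TS (F : List ι → ℝ) (j : ℕ) (l : List ι) : ℝ := ∑ f : Fin j → ι, F (l ++ List.ofFn f)

lemma TS_zero (F : List ι → ℝ) (l : List ι) : TS F 0 l = F l := by simp [TS]

lemma TS_succ (F : List ι → ℝ) (j : ℕ) (l : List ι) :
    TS F (j + 1) l = ∑ i, TS F j (l ++ [i]) := by
  unfold TS
  rw [← (Fin.consEquiv (fun _ : Fin (j + 1) => ι)).sum_comp, Fintype.sum_prod_type]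
  simp [Fin.consEquiv, List.ofFn_succ]

/-- The cut set of a stopping rule, truncated at depth `n`. -/
def cut (st : List ι → Prop) : ℕ → List ι → Finset (List ι)
  | 0, l => {l}
  | n + 1, l => if st l then {l} else Finset.univ.biUnion (fun i => cut st n (l ++ [i]))

lemma cut_prefix {st : List ι → Prop} {n : ℕ} : ∀ {l w : List ι}, w ∈ cut st n l → l <+: w := by
  induction n with
  | zero => intro l w h; simp [cut] at h; simp [h]
  | succ n ih =>
    intro l w h
    rw [cut] at h
    split_ifs at h
    · simp at h; simp [h]
    · simp only [Finset.mem_biUnion, Finset.mem_univ, true_and] at h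
      obtain ⟨i, hi⟩ := h
      exact (List.prefix_append _ _).trans (ih hi)

lemma cut_length {st : List ι → Prop} {n : ℕ} : ∀ {l w : List ι}, w ∈ cut st n l →
    w.length ≤ l.length + n := by
  induction n with
  | zero => intro l w h; simp [cut] at h; simp [h]
  | succ n ih =>
    intro l w h
    rw [cut] at h
    split_ifs at h
    · simp at h; simp [h]
    · simp only [Finset.mem_biUnion, Finset.mem_univ, true_and] at h
      obtain ⟨i, hi⟩ := h
      have := ih hi
      simp at this; omega

lemma prefix_singleton_inj {l w : List ι} {i j : ι} (h : l ++ [i] <+: w) (h' : l ++ [j] <+: w) :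
    i = j := by
  have := List.prefix_of_prefix_length_le h h' (by simp)
  have := this.eq_of_length (by simp)
  simpa using this

lemma cut_antichain {st : List ι → Prop} {n : ℕ} : ∀ {l w w' : List ι}, w ∈ cut st n l →
    w' ∈ cut st n l → w <+: w' → w = w' := by
  induction n with
  | zero => intro l w w' h h'; simp [cut] at h h'; simp [h, h']
  | succ n ih =>
    intro l w w' h h' hp
    rw [cut] at h h'
    split_ifs at h h'
    · simp at h h'; simp [h, h']
    · simp only [Finset.mem_biUnion, Finset.mem_univ, true_and] at h h'
      obtain ⟨i, hi⟩ := h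
      obtain ⟨j, hj⟩ := h'
      have := prefix_singleton_inj ((cut_prefix hi).trans hp) (cut_prefix hj)
      subst this
      exact ih hi hj hp

lemma cut_pd (st : List ι → Prop) (n : ℕ) (l : List ι) :
    Set.PairwiseDisjoint (↑(Finset.univ : Finset ι)) (fun i => cut st n (l ++ [i])) := by
  intro i _ j _ hij
  refine Finset.disjoint_left.2 fun w hi hj => hij ?_
  exact prefix_singleton_inj (cut_prefix hi) (cut_prefix hj)

lemma cut_sum {M : Type*} [AddCommMonoid M] {st : List ι → Prop} {N : ℕ} (Φ : List ι → M)
    (h : ∀ l, l.length < N → Φ l = ∑ i, Φ (l ++ [i])) {n : ℕ} :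
    ∀ {l : List ι}, l.length + n ≤ N → ∑ w ∈ cut st n l, Φ w = Φ l := by
  induction n with
  | zero => intro l _; simp [cut]
  | succ n ih =>
    intro l hl
    rw [cut]
    split_ifs
    · simp
    · rw [Finset.sum_biUnion (cut_pd st n l), h l (by omega)]
      exact Finset.sum_congr rfl fun i _ => ih (by simp; omega)

lemma cut_sum_ge {st : List ι → Prop} (Φ : List ι → ℝ)
    (h : ∀ l, Φ l ≤ ∑ i, Φ (l ++ [i])) {n : ℕ} :
    ∀ {l : List ι}, Φ l ≤ ∑ w ∈ cut st n l, Φ w := by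
  induction n with
  | zero => intro l; simp [cut]
  | succ n ih =>
    intro l
    rw [cut]
    split_ifs
    · simp
    · rw [Finset.sum_biUnion (cut_pd st n l)]
      exact (h l).trans (Finset.sum_le_sum fun i _ => ih)

lemma cut_sum_le {st : List ι → Prop} (F : List ι → ℝ) (h0 : ∀ l, 0 ≤ F l) {n : ℕ} :
    ∀ {l : List ι}, ∑ w ∈ cut st n l, F w ≤ ∑ j ∈ Finset.range (n + 1), TS F j l := by
  induction n with
  | zero => intro l; simp [cut, TS_zero]
  | succ n ih =>
    intro l
    rw [cut, Finset.sum_range_succ']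
    have hTS : ∀ j l, 0 ≤ TS F j l := fun j l => Finset.sum_nonneg fun _ _ => h0 _
    split_ifs
    · rw [TS_zero]; simp
      exact Finset.sum_nonneg fun _ _ => hTS _ _
    · rw [Finset.sum_biUnion (cut_pd st n l)]
      simp_rw [TS_succ]
      rw [Finset.sum_comm]
      exact (Finset.sum_le_sum fun i _ => ih).trans (le_add_of_nonneg_right (hTS _ _))

lemma cut_halt {st : List ι → Prop} {N : ℕ} (hst : ∀ l : List ι, N ≤ l.length → st l) {n : ℕ} :
    ∀ {l w : List ι}, N ≤ l.length + n → w ∈ cut st n l → st w := by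
  induction n with
  | zero => intro l w hl h; simp [cut] at h; subst h; exact hst _ hl
  | succ n ih =>
    intro l w hl h
    rw [cut] at h
    split_ifs at h with hs
    · simp at h; subst h; exact hs
    · simp only [Finset.mem_biUnion, Finset.mem_univ, true_and] at h
      obtain ⟨i, hi⟩ := h
      exact ih (by simp; omega) hi

lemma cut_dropLast {st : List ι → Prop} {n : ℕ} :
    ∀ {l w : List ι}, w ∈ cut st n l → w = l ∨ ¬ st w.dropLast := by
  induction n with
  | zero => intro l w h; simp [cut] at h; simp [h]
  | succ n ih =>
    intro l w h
    rw [cut] at h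
    split_ifs at h with hs
    · simp at h; simp [h]
    · simp only [Finset.mem_biUnion, Finset.mem_univ, true_and] at h
      obtain ⟨i, hi⟩ := h
      rcases ih hi with h | h
      · right; rw [h]; simpa using hs
      · exact Or.inr h

lemma lower_sub (ψ : List ι → ℝ) (h0 : ∀ l, 0 ≤ ψ l) (h1 : ψ [] = 1)
    (hsub : ∀ l l', ψ (l ++ l') ≤ ψ l * ψ l') (hunb : ∀ K, ∃ k, K < TS ψ k [])
    (st : List ι → Prop) (n : ℕ) : 1 ≤ ∑ w ∈ cut st n [], ψ w := by
  by_contra! hlt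
  have hTS : ∀ j l, 0 ≤ TS ψ j l := fun j l => Finset.sum_nonneg fun _ _ => h0 _
  have hnil : ∀ w ∈ cut st n [], 1 ≤ w.length := by
    intro w hw
    by_contra! h
    have : w = [] := List.length_eq_zero_iff.1 (by omega)
    subst this
    have := Finset.single_le_sum (f := ψ) (fun i _ => h0 i) hw
    linarith
  set K := ∑ j ∈ Finset.range (n + 1), TS ψ j [] with hK
  have hKnn : 0 ≤ K := Finset.sum_nonneg fun _ _ => hTS _ _
  have hb : ∀ k, TS ψ k [] ≤ K := by
    intro k
    induction k using Nat.strong_induction_on with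
    | _ k ih =>
      by_cases hk : k < n + 1
      · exact Finset.single_le_sum (f := fun j => TS ψ j []) (fun j _ => hTS j _)
          (Finset.mem_range.2 hk)
      · have e := cut_sum (st := st) (N := k) (fun l => TS ψ (k - l.length) l) (by
          intro l hl
          have : k - l.length = (k - (l.length + 1)) + 1 := by omega
          simp only [this, TS_succ, List.length_append, List.length_singleton])
          (n := n) (l := []) (by simp; omega)
        simp only [List.length_nil, Nat.sub_zero] at e
        rw [← e]
        have : ∀ w ∈ cut st n [], TS ψ (k - w.length) w ≤ ψ w * K := by
          intro w hw
          have h2 : TS ψ (k - w.length) w ≤ ψ w * TS ψ (k - w.length) [] := by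
            unfold TS
            rw [Finset.mul_sum]
            exact Finset.sum_le_sum fun f _ => by simpa using hsub w (List.ofFn f)
          refine h2.trans (mul_le_mul_of_nonneg_left (ih _ ?_) (h0 _))
          have := hnil w hw
          omega
        refine (Finset.sum_le_sum this).trans ?_
        rw [← Finset.sum_mul]
        exact mul_le_of_le_one_left hKnn hlt.le
  obtain ⟨k, hk⟩ := hunb K
  exact absurd (hb k) (not_le.2 hk)

lemma lower_super (ψ : List ι → ℝ) (h0 : ∀ l, 0 ≤ ψ l) (h1 : ψ [] = 1)
    (hsup : ∀ l l', ψ l * ψ l' ≤ ψ (l ++ l')) (m : List ι → ℝ)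
    (hext : ∀ l l', ψ (l ++ l') ≤ ψ l * m l') (k : ℕ) (hk0 : 0 < k) (hk : 1 ≤ TS ψ k []) :
    ∃ c : ℝ, 0 < c ∧ ∀ (st : List ι → Prop) (n : ℕ), c ≤ ∑ w ∈ cut st n [], ψ w := by
  have hTS : ∀ j l, 0 ≤ TS ψ j l := fun j l => Finset.sum_nonneg fun _ _ => h0 _
  set C := ∑ j ∈ Finset.range k, TS m j [] with hC
  set Φ : List ι → ℝ := fun l => ∑ j ∈ Finset.range k, TS ψ j l with hΦ
  have hle : ∀ l, Φ l ≤ C * ψ l := by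
    intro l
    rw [hC, Finset.sum_mul]
    refine Finset.sum_le_sum fun j _ => ?_
    unfold TS
    rw [Finset.sum_mul]
    exact Finset.sum_le_sum fun f _ => by simpa [mul_comm] using hext l (List.ofFn f)
  have h1Φ : 1 ≤ Φ [] := by
    rw [← h1, ← TS_zero ψ []]
    exact Finset.single_le_sum (f := fun j => TS ψ j []) (fun j _ => hTS j _)
          (Finset.mem_range.2 hk0)
  have hCpos : 0 < C := by
    have := hle []
    rw [h1] at this; linarith
  refine ⟨C⁻¹, by positivity, fun st n => ?_⟩
  have := cut_sum_ge (st := st) Φ (by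
    intro l
    have e : ∑ i, Φ (l ++ [i]) = ∑ j ∈ Finset.range k, TS ψ (j + 1) l := by
      simp only [hΦ, TS_succ]; rw [Finset.sum_comm]
    rw [e]
    have e2 : Φ l + TS ψ k l = ∑ j ∈ Finset.range k, TS ψ (j + 1) l + ψ l := by
      rw [← TS_zero ψ l, ← Finset.sum_range_succ' (fun j => TS ψ j l), Finset.sum_range_succ]
    have h3 : ψ l ≤ TS ψ k l := by
      calc ψ l ≤ ψ l * TS ψ k [] := le_mul_of_one_le_right (h0 l) hk
        _ ≤ _ := by
          unfold TS; rw [Finset.mul_sum]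
          exact Finset.sum_le_sum fun f _ => by simpa using hsup l (List.ofFn f)
    linarith) (n := n) (l := [])
  rw [inv_le_iff_one_le_mul₀ hCpos, mul_comm, Finset.mul_sum]
  exact (h1Φ.trans this).trans (Finset.sum_le_sum fun w _ => hle w)

lemma PsiSV_eq_TS (B : IFSData ι) (p : ι → ℝ) (τ1 τ2 : ℝ → ℝ) (k : ℕ) (s q : ℝ) :
    PsiSV B p τ1 τ2 k s q = TS (psiSV B p τ1 τ2 s q) k [] := rfl

lemma P_mono {B : IFSData ι} (hc : ∀ i, 0 < B.c i) (hd : ∀ i, 0 < B.d i)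
    {M : ℝ} (hM : 0 < M) (hcM : ∀ i, B.c i ≤ M) (hdM : ∀ i, B.d i ≤ M)
    {p : ι → ℝ} (hp : ∀ i, 0 < p i) {τ1 τ2 : ℝ → ℝ} {q s s' P P' : ℝ} (hs : s ≤ s')
    (hP : Tendsto (fun k : ℕ => PsiSV B p τ1 τ2 k s q ^ ((k : ℝ)⁻¹)) atTop (nhds P))
    (hP' : Tendsto (fun k : ℕ => PsiSV B p τ1 τ2 k s' q ^ ((k : ℝ)⁻¹)) atTop (nhds P')) :
    P' ≤ M ^ (s' - s) * P := by
  refine le_of_tendsto_of_tendsto hP' (hP.const_mul _) ?_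
  filter_upwards [eventually_gt_atTop 0] with k hk
  have hk' : (0 : ℝ) < k := by exact_mod_cast hk
  have h1 : PsiSV B p τ1 τ2 k s' q ≤ (M ^ (s' - s)) ^ (k : ℝ) * PsiSV B p τ1 τ2 k s q := by
    unfold PsiSV
    rw [Finset.mul_sum]
    refine Finset.sum_le_sum fun f _ => ?_
    set l := List.ofFn f with hl
    obtain ⟨g1, g2⟩ := dims_pos hc hd l
    have g : 0 < B.alpha2 l := lt_min g1 g2
    have g3 := psi_pos hc hd hp τ1 τ2 s q l
    have e : psiSV B p τ1 τ2 s' q l = B.alpha2 l ^ (s' - s) * psiSV B p τ1 τ2 s q l := by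
      unfold psiSV
      rw [show s' - tauW B τ1 τ2 l q = (s' - s) + (s - tauW B τ1 τ2 l q) by ring,
        Real.rpow_add g]
      ring
    rw [e]
    refine mul_le_mul_of_nonneg_right ?_ g3.le
    rw [← Real.rpow_mul hM.le, mul_comm, Real.rpow_mul hM.le, Real.rpow_natCast]
    refine Real.rpow_le_rpow g.le ?_ (by linarith)
    have := (dims_le_pow hc hd hcM hdM l).1
    simp only [hl, List.length_ofFn] at this
    exact (min_le_left _ _).trans this
  have h0 : ∀ s, 0 ≤ PsiSV B p τ1 τ2 k s q := fun s =>
    Finset.sum_nonneg fun f _ => (psi_pos hc hd hp τ1 τ2 s q _).le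
  calc _ ≤ ((M ^ (s' - s)) ^ (k : ℝ) * PsiSV B p τ1 τ2 k s q) ^ ((k : ℝ)⁻¹) :=
        Real.rpow_le_rpow (h0 _) h1 (by positivity)
    _ = _ := by
        rw [Real.mul_rpow (by positivity) (h0 _), ← Real.rpow_mul (by positivity),
          mul_inv_cancel₀ hk'.ne', Real.rpow_one]

/-- Upper bound over cuts for `s > γ`. -/
lemma cut_upper {B : IFSData ι} (hc : ∀ i, 0 < B.c i) (hd : ∀ i, 0 < B.d i)
    {p : ι → ℝ} (hp : ∀ i, 0 < p i) {τ1 τ2 : ℝ → ℝ} {q s P : ℝ}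
    (hP : Tendsto (fun k : ℕ => PsiSV B p τ1 τ2 k s q ^ ((k : ℝ)⁻¹)) atTop (nhds P))
    (hlt : P < 1) : ∃ C : ℝ, 0 < C ∧ ∀ (st : List ι → Prop) (n : ℕ),
      ∑ w ∈ cut st n [], psiSV B p τ1 τ2 s q w ≤ C := by
  have h0 : ∀ k, 0 ≤ PsiSV B p τ1 τ2 k s q := fun k =>
    Finset.sum_nonneg fun f _ => (psi_pos hc hd hp τ1 τ2 s q _).le
  have hPnn : 0 ≤ P := ge_of_tendsto' hP fun k => Real.rpow_nonneg (h0 k) _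
  obtain ⟨r, hr1, hr2⟩ := exists_between hlt
  have hr0 : 0 < r := hPnn.trans_lt hr1
  have hev : ∀ᶠ k : ℕ in atTop, ‖PsiSV B p τ1 τ2 k s q‖ ≤ r ^ k := by
    filter_upwards [hP.eventually_lt_const hr1, eventually_gt_atTop 0] with k h hk
    have hk' : (0 : ℝ) < k := by exact_mod_cast hk
    rw [Real.norm_of_nonneg (h0 k), ← Real.rpow_natCast]
    have := Real.rpow_le_rpow (Real.rpow_nonneg (h0 k) _) h.le hk'.le
    rwa [← Real.rpow_mul (h0 k), inv_mul_cancel₀ hk'.ne', Real.rpow_one] at this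
  have hsum : Summable (fun k => PsiSV B p τ1 τ2 k s q) :=
    Summable.of_norm_bounded_eventually_nat (summable_geometric_of_lt_one hr0.le hr2) hev
  refine ⟨∑' k, PsiSV B p τ1 τ2 k s q + 1, by
    have h9 : 0 ≤ ∑' k, PsiSV B p τ1 τ2 k s q := tsum_nonneg h0
    linarith, fun st n => ?_⟩
  refine (cut_sum_le _ (fun l => (psi_pos hc hd hp τ1 τ2 s q l).le)).trans ?_
  have := hsum.sum_le_tsum (Finset.range (n + 1)) (fun k _ => h0 k)
  simp only [PsiSV_eq_TS] at this ⊢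
  linarith

lemma psi_nil (B : IFSData ι) (p : ι → ℝ) (τ1 τ2 : ℝ → ℝ) (s q : ℝ) :
    psiSV B p τ1 τ2 s q [] = 1 := by
  simp [psiSV, wordProb, IFSData.alpha1, IFSData.alpha2, dims_nil]

/-- Lower bound over cuts for `s < γ`. -/
lemma cut_lower {B : IFSData ι} (hc : ∀ i, 0 < B.c i) (hd : ∀ i, 0 < B.d i)
    {p : ι → ℝ} (hp : ∀ i, 0 < p i) {τ1 τ2 : ℝ → ℝ} {q s P : ℝ}
    (HS : (∀ i, B.swap i = false) ∨ τ1 q = τ2 q)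
    (hP : Tendsto (fun k : ℕ => PsiSV B p τ1 τ2 k s q ^ ((k : ℝ)⁻¹)) atTop (nhds P))
    (hlt : 1 < P) : ∃ C : ℝ, 0 < C ∧ ∀ (st : List ι → Prop) (n : ℕ),
      C ≤ ∑ w ∈ cut st n [], psiSV B p τ1 τ2 s q w := by
  have h0 : ∀ k, 0 ≤ PsiSV B p τ1 τ2 k s q := fun k =>
    Finset.sum_nonneg fun f _ => (psi_pos hc hd hp τ1 τ2 s q _).le
  obtain ⟨r, hr1, hr2⟩ := exists_between hlt
  have hev : ∀ᶠ k : ℕ in atTop, r ^ k ≤ PsiSV B p τ1 τ2 k s q ∧ 0 < k := by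
    filter_upwards [hP.eventually_const_lt hr2, eventually_gt_atTop 0] with k h hk
    have hk' : (0 : ℝ) < k := by exact_mod_cast hk
    refine ⟨?_, hk⟩
    rw [← Real.rpow_natCast]
    have := Real.rpow_le_rpow (by linarith) h.le hk'.le
    rwa [← Real.rpow_mul (h0 k), inv_mul_cancel₀ hk'.ne', Real.rpow_one] at this
  rcases le_total s (τ1 q + τ2 q) with hs | hs
  · refine ⟨1, one_pos, lower_sub _ (fun l => (psi_pos hc hd hp τ1 τ2 s q l).le)
      (psi_nil ..) (psi_sub hc hd hp HS hs) fun K => ?_⟩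
    have := (tendsto_pow_atTop_atTop_of_one_lt hr1).eventually_gt_atTop K
    obtain ⟨k, h1, h2, _⟩ := (this.and hev).exists
    exact ⟨k, h1.trans_le h2⟩
  · obtain ⟨k, h2, hk⟩ := hev.exists
    exact lower_super _ (fun l => (psi_pos hc hd hp τ1 τ2 s q l).le)
      (psi_nil ..) (psi_super hc hd hp HS hs) _ (psi_ext hc hd hp HS hs) k hk
      ((one_le_pow₀ hr1.le).trans h2)

end trees

section measure
variable {ι : Type}

/-- All the standing facts about the system. -/
structure Good [Fintype ι] (B : IFSData ι) (p : ι → ℝ) (μ : Measure (ℝ × ℝ))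
    (m M pm x₁ x₂ y₁ y₂ : ℝ) : Prop where
  m0 : 0 < m
  M1 : M < 1
  cm : ∀ i, m ≤ B.c i
  dm : ∀ i, m ≤ B.d i
  cM : ∀ i, B.c i ≤ M
  dM : ∀ i, B.d i ≤ M
  M0 : 0 < M
  m1 : m ≤ 1
  pm0 : 0 < pm
  pm1 : pm < 1
  pmp : ∀ i, pm ≤ p i
  psum : ∑ i, p i = 1
  self : μ = ∑ i : ι, ENNReal.ofReal (p i) • Measure.map (B.S i) μ
  hx : x₁ < x₂
  hy : y₁ < y₂
  sub : ∀ i, B.S i '' (Set.Ioo x₁ x₂ ×ˢ Set.Ioo y₁ y₂) ⊆ Set.Ioo x₁ x₂ ×ˢ Set.Ioo y₁ y₂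
  disj : Pairwise fun i j =>
      Disjoint (B.S i '' (Set.Ioo x₁ x₂ ×ˢ Set.Ioo y₁ y₂))
        (B.S j '' (Set.Ioo x₁ x₂ ×ˢ Set.Ioo y₁ y₂))
  supp : μ (Set.Icc x₁ x₂ ×ˢ Set.Icc y₁ y₂)ᶜ = 0

lemma S_cont (B : IFSData ι) (i : ι) : Continuous (B.S i) := by
  unfold IFSData.S
  split_ifs <;> fun_prop

lemma Sw_cont (B : IFSData ι) (l : List ι) : Continuous (B.Sw l) := by
  induction l with
  | nil => exact continuous_id
  | cons i l ih => rw [Sw_cons]; exact (S_cont B i).comp ih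

lemma Sw_singleton (B : IFSData ι) (i : ι) : B.Sw [i] = B.S i := rfl

lemma Sw_dist {B : IFSData ι} (hc : ∀ i, 0 < B.c i) (hd : ∀ i, 0 < B.d i) (l : List ι)
    (x y : ℝ × ℝ) : dist (B.Sw l x).1 (B.Sw l y).1 = (B.dims l).1 *
      (if B.swapW l then dist x.2 y.2 else dist x.1 y.1) ∧
    dist (B.Sw l x).2 (B.Sw l y).2 = (B.dims l).2 *
      (if B.swapW l then dist x.1 y.1 else dist x.2 y.2) := by
  obtain ⟨σ₁, σ₂, t₁, t₂, h1, h2, h⟩ := Sw_form B l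
  obtain ⟨g1, g2⟩ := dims_pos hc hd l
  have a1 : |σ₁| = 1 := by rcases h1 with rfl | rfl <;> simp
  have a2 : |σ₂| = 1 := by rcases h2 with rfl | rfl <;> simp
  have key : ∀ σ d t u v : ℝ, |σ| = 1 → 0 < d →
      dist (σ * (d * u) + t) (σ * (d * v) + t) = d * dist u v := by
    intro σ d t u v hσ hd'
    rw [Real.dist_eq, Real.dist_eq, show σ * (d * u) + t - (σ * (d * v) + t) = σ * (d * (u - v)) by ring,
      abs_mul, abs_mul, hσ, one_mul, abs_of_pos hd']
  rw [h x, h y]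
  constructor
  · rw [key _ _ _ _ _ a1 g1]; split_ifs <;> rfl
  · rw [key _ _ _ _ _ a2 g2]; split_ifs <;> rfl

lemma Sw_dist_le {B : IFSData ι} (hc : ∀ i, 0 < B.c i) (hd : ∀ i, 0 < B.d i) {M : ℝ}
    (hcM : ∀ i, B.c i ≤ M) (hdM : ∀ i, B.d i ≤ M) (l : List ι) (x y : ℝ × ℝ) :
    dist (B.Sw l x) (B.Sw l y) ≤ M ^ l.length * dist x y := by
  obtain ⟨e1, e2⟩ := Sw_dist hc hd l x y
  obtain ⟨g1, g2⟩ := dims_pos hc hd l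
  obtain ⟨k1, k2⟩ := dims_le_pow hc hd hcM hdM l
  have d1 : dist x.1 y.1 ≤ dist x y := le_max_left _ _
  have d2 : dist x.2 y.2 ≤ dist x y := le_max_right _ _
  rw [Prod.dist_eq, e1, e2]
  have : 0 ≤ M ^ l.length := g1.le.trans k1
  refine max_le (mul_le_mul k1 ?_ ?_ this) (mul_le_mul k2 ?_ ?_ this) <;>
    split_ifs <;> first | assumption | exact dist_nonneg

lemma closure_R {x₁ x₂ y₁ y₂ : ℝ} (hx : x₁ < x₂) (hy : y₁ < y₂) :
    closure (Set.Ioo x₁ x₂ ×ˢ Set.Ioo y₁ y₂) = Set.Icc x₁ x₂ ×ˢ Set.Icc y₁ y₂ := by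
  rw [closure_prod_eq, closure_Ioo hx.ne, closure_Ioo hy.ne]

lemma S_Rc {B : IFSData ι} {x₁ x₂ y₁ y₂ : ℝ} (hx : x₁ < x₂) (hy : y₁ < y₂) {i : ι}
    (h : B.S i '' (Set.Ioo x₁ x₂ ×ˢ Set.Ioo y₁ y₂) ⊆ Set.Ioo x₁ x₂ ×ˢ Set.Ioo y₁ y₂) :
    MapsTo (B.S i) (Set.Icc x₁ x₂ ×ˢ Set.Icc y₁ y₂) (Set.Icc x₁ x₂ ×ˢ Set.Icc y₁ y₂) := by
  rw [← closure_R hx hy]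
  exact (mapsTo_iff_image_subset.2 h).closure (S_cont B i)

lemma supp_Rc [Fintype ι] {B : IFSData ι} (hc : ∀ i, 0 < B.c i) (hd : ∀ i, 0 < B.d i) {M : ℝ}
    (hM0 : 0 < M) (hM1 : M < 1) (hcM : ∀ i, B.c i ≤ M) (hdM : ∀ i, B.d i ≤ M)
    {p : ι → ℝ} (hp : ∀ i, 0 < p i) (hpsum : ∑ i, p i = 1) {μ : Measure (ℝ × ℝ)}
    (hcpt : ∃ K : Set (ℝ × ℝ), IsCompact K ∧ μ Kᶜ = 0)
    (hself : μ = ∑ i : ι, ENNReal.ofReal (p i) • Measure.map (B.S i) μ)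
    {x₁ x₂ y₁ y₂ : ℝ} (hx : x₁ < x₂) (hy : y₁ < y₂)
    (h : ∀ i, B.S i '' (Set.Ioo x₁ x₂ ×ˢ Set.Ioo y₁ y₂) ⊆ Set.Ioo x₁ x₂ ×ˢ Set.Ioo y₁ y₂) :
    μ (Set.Icc x₁ x₂ ×ˢ Set.Icc y₁ y₂)ᶜ = 0 := by
  set R := Set.Icc x₁ x₂ ×ˢ Set.Icc y₁ y₂ with hR
  have hRc : IsCompact R := isCompact_Icc.prod isCompact_Icc
  have hRn : R.Nonempty := ⟨(x₁, y₁), by simp [hR, hx.le, hy.le]⟩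
  let A : ℝ → Set (ℝ × ℝ) := fun r => {x | r < Metric.infDist x R}
  have hAo : ∀ r, IsOpen (A r) := fun r => isOpen_lt continuous_const (Metric.continuous_infDist_pt R)
  have hcontr : ∀ i x, Metric.infDist (B.S i x) R ≤ M * Metric.infDist x R := by
    intro i x
    obtain ⟨y, hy', e⟩ := hRc.exists_infDist_eq_dist hRn x
    rw [e]
    refine (Metric.infDist_le_dist_of_mem (S_Rc hx hy (h i) hy')).trans ?_
    simpa [Sw_singleton] using Sw_dist_le hc hd hcM hdM [i] x y
  have step : ∀ r, μ (A r) ≤ μ (A (r / M)) := by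
    intro r
    conv_lhs => rw [hself]
    rw [Measure.finset_sum_apply]
    calc ∑ i, (ENNReal.ofReal (p i) • Measure.map (B.S i) μ) (A r)
        ≤ ∑ i, ENNReal.ofReal (p i) * μ (A (r / M)) := by
          refine Finset.sum_le_sum fun i _ => ?_
          rw [Measure.smul_apply, smul_eq_mul, Measure.map_apply (S_cont B i).measurable
            (hAo r).measurableSet]
          gcongr
          intro x hx'
          simp only [A, mem_preimage, mem_setOf_eq] at hx' ⊢
          rw [div_lt_iff₀ hM0, mul_comm]
          exact hx'.trans_le (hcontr i x)
      _ = μ (A (r / M)) := by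
          rw [← Finset.sum_mul, ← ENNReal.ofReal_sum_of_nonneg fun i _ => (hp i).le, hpsum]
          simp
  have steps : ∀ n r, μ (A r) ≤ μ (A (r / M ^ n)) := by
    intro n
    induction n with
    | zero => intro r; simp
    | succ n ih =>
      intro r
      refine (ih r).trans ((step _).trans_eq ?_)
      rw [div_div, pow_succ]
  obtain ⟨K, hK, hK0⟩ := hcpt
  obtain ⟨T, hT⟩ : ∃ T, ∀ x ∈ K, Metric.infDist x R ≤ T := by
    obtain ⟨T, hT⟩ := (hK.image (Metric.continuous_infDist_pt R)).bddAbove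
    exact ⟨T, fun x hx => hT ⟨x, hx, rfl⟩⟩
  have hA0 : ∀ r, 0 < r → μ (A r) = 0 := by
    intro r hr
    have ht : Tendsto (fun n : ℕ => r / M ^ n) atTop atTop := by
      have := (tendsto_pow_atTop_atTop_of_one_lt ((one_lt_inv₀ hM0).2 hM1)).const_mul_atTop hr
      simpa [div_eq_mul_inv] using this
    obtain ⟨n, hn⟩ := (ht.eventually_ge_atTop T).exists
    refine le_antisymm ((steps n r).trans ?_) zero_le
    rw [← hK0]
    refine measure_mono fun x hx' hxK => ?_
    exact absurd (hT x hxK) (not_le.2 (hn.trans_lt hx'))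
  have hun : Rᶜ ⊆ ⋃ n : ℕ, A (1 / ((n : ℝ) + 1)) := by
    intro x hx'
    have h1 : 0 < Metric.infDist x R := (hRc.isClosed.notMem_iff_infDist_pos hRn).1 hx'
    obtain ⟨n, hn⟩ := exists_nat_one_div_lt h1
    exact mem_iUnion.2 ⟨n, hn⟩
  exact measure_mono_null hun (measure_iUnion_null fun n => hA0 _ (by positivity))

section good
variable [Fintype ι] {B : IFSData ι} {p : ι → ℝ} {μ : Measure (ℝ × ℝ)}
  {m M pm x₁ x₂ y₁ y₂ : ℝ}

lemma Good.hc (G : Good B p μ m M pm x₁ x₂ y₁ y₂) (i : ι) : 0 < B.c i := G.m0.trans_le (G.cm i)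
lemma Good.hd (G : Good B p μ m M pm x₁ x₂ y₁ y₂) (i : ι) : 0 < B.d i := G.m0.trans_le (G.dm i)
lemma Good.hp (G : Good B p μ m M pm x₁ x₂ y₁ y₂) (i : ι) : 0 < p i := G.pm0.trans_le (G.pmp i)

lemma Good.Sw_Rc (G : Good B p μ m M pm x₁ x₂ y₁ y₂) (l : List ι) :
    MapsTo (B.Sw l) (Set.Icc x₁ x₂ ×ˢ Set.Icc y₁ y₂) (Set.Icc x₁ x₂ ×ˢ Set.Icc y₁ y₂) := by
  induction l with
  | nil => exact mapsTo_id _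
  | cons i l ih => rw [Sw_cons]; exact (S_Rc G.hx G.hy (G.sub i)).comp ih

lemma Good.Sw_R (G : Good B p μ m M pm x₁ x₂ y₁ y₂) (l : List ι) :
    MapsTo (B.Sw l) (Set.Ioo x₁ x₂ ×ˢ Set.Ioo y₁ y₂) (Set.Ioo x₁ x₂ ×ˢ Set.Ioo y₁ y₂) := by
  induction l with
  | nil => exact mapsTo_id _
  | cons i l ih => rw [Sw_cons]; exact (mapsTo_iff_image_subset.2 (G.sub i)).comp ih

lemma Good.self_cut (G : Good B p μ m M pm x₁ x₂ y₁ y₂) (st : List ι → Prop) (n : ℕ) :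
    μ = ∑ w ∈ cut st n [], ENNReal.ofReal (wordProb p w) • Measure.map (B.Sw w) μ := by
  rw [cut_sum (N := n) (fun w => ENNReal.ofReal (wordProb p w) • Measure.map (B.Sw w) μ) _ (by simp)]
  · simp [wordProb, Sw_nil, Measure.map_id]
  · intro l _
    conv_lhs => rw [G.self]
    rw [Measure.map_finset_sum' (Sw_cont B l).aemeasurable, Finset.smul_sum]
    refine Finset.sum_congr rfl fun i _ => ?_
    rw [Measure.map_smul, Measure.map_map (Sw_cont B l).measurable (S_cont B i).measurable,
      Sw_append, Sw_singleton, smul_smul, wordProb_append,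
      ENNReal.ofReal_mul (wordProb_pos G.hp l).le]
    simp [wordProb]

lemma Good.cut_apply (G : Good B p μ m M pm x₁ x₂ y₁ y₂) (st : List ι → Prop) (n : ℕ)
    {E : Set (ℝ × ℝ)} (hE : MeasurableSet E) :
    μ E = ∑ w ∈ cut st n [], ENNReal.ofReal (wordProb p w) * μ (B.Sw w ⁻¹' E) := by
  conv_lhs => rw [G.self_cut st n]
  rw [Measure.finset_sum_apply]
  refine Finset.sum_congr rfl fun w _ => ?_
  rw [Measure.smul_apply, smul_eq_mul, Measure.map_apply (Sw_cont B w).measurable hE]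

lemma wordProb_ge {pm : ℝ} (h0 : 0 ≤ pm) (h : ∀ i, pm ≤ p i) (l : List ι) :
    pm ^ l.length ≤ wordProb p l := by
  induction l with
  | nil => simp [wordProb]
  | cons i l ih =>
    simp only [wordProb, List.map_cons, List.prod_cons, List.length_cons, pow_succ'] at ih ⊢
    exact mul_le_mul (h i) ih (by positivity) (h0.trans (h i))

lemma Good.Rc_one (G : Good B p μ m M pm x₁ x₂ y₁ y₂) [IsProbabilityMeasure μ] :
    μ (Set.Icc x₁ x₂ ×ˢ Set.Icc y₁ y₂) = 1 := by
  have h := G.supp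
  rwa [prob_compl_eq_zero_iff (measurableSet_Icc.prod measurableSet_Icc)] at h

lemma Good.polyLow (G : Good B p μ m M pm x₁ x₂ y₁ y₂) [IsProbabilityMeasure μ] :
    PolyLow μ := by
  set R := Set.Icc x₁ x₂ ×ˢ Set.Icc y₁ y₂ with hR
  set D := max (x₂ - x₁) (y₂ - y₁) with hD
  have hDpos : 0 < D := lt_max_of_lt_left (by linarith [G.hx])
  have hdR : ∀ x ∈ R, ∀ y ∈ R, dist x y ≤ D := by
    rintro ⟨a, b⟩ ⟨ha, hb⟩ ⟨a', b'⟩ ⟨ha', hb'⟩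
    rw [Prod.dist_eq]
    exact max_le_max (Real.dist_le_of_mem_Icc ha ha') (Real.dist_le_of_mem_Icc hb hb')
  have hlM : Real.log M < 0 := Real.log_neg G.M0 G.M1
  set A := Real.log pm / Real.log M with hA
  have hA0 : 0 < A := div_pos_of_neg_of_neg (Real.log_neg G.pm0 G.pm1) hlM
  have hMA : M ^ A = pm := by
    rw [Real.rpow_def_of_pos G.M0, hA, mul_div_cancel₀ _ hlM.ne, Real.exp_log G.pm0]
  have hM0 := G.M0
  refine ⟨min 1 ((M / D) ^ A), A, by positivity, hA0, fun δ h0 h1 => ?_⟩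
  have hex : ∃ n : ℕ, M ^ n * D < δ := by
    have := (tendsto_pow_atTop_nhds_zero_of_lt_one G.M0.le G.M1).mul_const D
    rw [zero_mul] at this
    exact (this.eventually_lt_const h0).exists
  set n := Nat.find hex with hn
  have hn1 : M ^ n * D < δ := Nat.find_spec hex
  have hbound : min 1 ((M / D) ^ A) * δ ^ A ≤ pm ^ n := by
    rcases Nat.eq_zero_or_pos n with h | h
    · rw [h, pow_zero]
      exact mul_le_one₀ (min_le_left _ _) (by positivity) (Real.rpow_le_one h0.le h1.le hA0.le)
    · have h2 : δ ≤ M ^ (n - 1) * D := not_lt.1 (Nat.find_min hex (by omega))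
      calc min 1 ((M / D) ^ A) * δ ^ A ≤ (M / D) ^ A * (M ^ (n - 1) * D) ^ A := by
            gcongr; exact min_le_right _ _
        _ = (M ^ n) ^ A := by
            rw [← Real.mul_rpow (by positivity) (by positivity)]
            congr 1
            obtain ⟨k, hk⟩ : ∃ k, n = k + 1 := ⟨n - 1, by omega⟩
            rw [hk, Nat.add_sub_cancel, pow_succ]; field_simp
        _ = pm ^ n := by
            rw [← hMA, ← Real.rpow_natCast, ← Real.rpow_natCast, ← Real.rpow_mul G.M0.le,
              ← Real.rpow_mul G.M0.le, mul_comm]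
  have hlen : ∀ w ∈ cut (fun _ : List ι => False) n [], w.length = n := by
    intro w hw
    have h3 : ∀ k (l w : List ι), w ∈ cut (fun _ : List ι => False) k l → w.length = l.length + k := by
      intro k
      induction k with
      | zero => intro l w h; simp [cut] at h; simp [h]
      | succ k ih =>
        intro l w h
        simp only [cut, if_false, Finset.mem_biUnion, Finset.mem_univ, true_and] at h
        obtain ⟨i, hi⟩ := h
        have := ih _ _ hi
        simp at this; omega
    simpa using h3 n [] w hw
  set U := ⋃ w ∈ cut (fun _ : List ι => False) n [], B.Sw w '' R with hU
  have hRc : IsCompact R := isCompact_Icc.prod isCompact_Icc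
  have hUm : MeasurableSet U := by
    refine Finset.measurableSet_biUnion _ fun w _ => ?_
    exact (hRc.image (Sw_cont B w)).measurableSet
  have hU0 : μ Uᶜ = 0 := by
    rw [G.cut_apply (fun _ => False) n hUm.compl]
    refine Finset.sum_eq_zero fun w hw => ?_
    have : μ (B.Sw w ⁻¹' Uᶜ) = 0 := by
      refine measure_mono_null (t := Rᶜ) ?_ G.supp
      intro x hx hxR
      refine hx ?_
      exact mem_biUnion (Finset.mem_coe.2 hw) ⟨x, hxR, rfl⟩
    rw [this, mul_zero]
  have : ∀ᵐ x ∂μ, x ∈ U := hU0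
  filter_upwards [this] with x hx
  obtain ⟨w, hw, z, hz, rfl⟩ := mem_iUnion₂.1 hx
  have hsub : R ⊆ B.Sw w ⁻¹' Metric.ball (B.Sw w z) δ := by
    intro y hy
    have := Sw_dist_le G.hc G.hd G.cM G.dM w y z
    rw [hlen w hw] at this
    refine lt_of_le_of_lt (this.trans ?_) hn1
    gcongr
    exact hdR _ hy _ hz
  rw [G.cut_apply (fun _ => False) n Metric.isOpen_ball.measurableSet]
  calc ENNReal.ofReal (min 1 ((M / D) ^ A) * δ ^ A) ≤ ENNReal.ofReal (wordProb p w) * 1 := by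
        rw [mul_one]
        refine ENNReal.ofReal_le_ofReal (hbound.trans ?_)
        have := wordProb_ge G.pm0.le G.pmp w
        rwa [hlen w hw] at this
    _ ≤ ENNReal.ofReal (wordProb p w) * μ (B.Sw w ⁻¹' Metric.ball (B.Sw w z) δ) := by
        gcongr
        rw [← G.Rc_one]; exact measure_mono hsub
    _ ≤ _ := Finset.single_le_sum
        (f := fun w => ENNReal.ofReal (wordProb p w) * μ (B.Sw w ⁻¹' Metric.ball _ δ))
        (fun _ _ => zero_le) hw

end good

lemma PolyLow_map {X Y : Type*} [MeasurableSpace X] [PseudoMetricSpace X] [BorelSpace X]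
    [MeasurableSpace Y] [PseudoMetricSpace Y] [BorelSpace Y] [SecondCountableTopology Y]
    {μ : Measure X} [IsProbabilityMeasure μ] (h : PolyLow μ) (f : X → Y) (hf : Measurable f)
    (hl : ∀ x y, dist (f x) (f y) ≤ dist x y) : PolyLow (Measure.map f μ) := by
  have : IsProbabilityMeasure (Measure.map f μ) := Measure.isProbabilityMeasure_map hf.aemeasurable
  obtain ⟨c, A, hc, hA, hl'⟩ := h
  refine ⟨c, A, hc, hA, fun δ h0 h1 => ?_⟩
  have hmeas : Measurable fun x => (Measure.map f μ) (Metric.ball x δ) := by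
    have hs : MeasurableSet {z : Y × Y | dist z.2 z.1 < δ} :=
      (isOpen_lt (by fun_prop) (by fun_prop)).measurableSet
    exact measurable_measure_prodMk_left hs
  rw [ae_map_iff hf.aemeasurable (measurableSet_le measurable_const hmeas)]
  filter_upwards [hl' δ h0 h1] with x hx
  rw [Measure.map_apply hf Metric.isOpen_ball.measurableSet]
  exact hx.trans (measure_mono fun y hy => (hl y x).trans_lt hy)

end measure

section geometry
variable {ι : Type}

/-- Mesh cells of the line. -/
def cell1 (δ : ℝ) (x : ℝ) : ℤ := ⌊x / δ⌋

/-- Mesh cells of the plane. -/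
def cell2 (δ : ℝ) (x : ℝ × ℝ) : ℤ × ℤ := (cell1 δ x.1, cell1 δ x.2)

/-- Neighbouring cells. -/
def nb1 (k : ℕ) (a : ℤ) : Finset ℤ := Finset.Icc (a - k) (a + k)

/-- Neighbouring cells in the plane. -/
def nb2 (k : ℕ) (a : ℤ × ℤ) : Finset (ℤ × ℤ) := nb1 k a.1 ×ˢ nb1 k a.2

lemma nb1_card (k : ℕ) (a : ℤ) : (nb1 k a).card = 2 * k + 1 := by
  unfold nb1; rw [Int.card_Icc]; omega

lemma nb2_card (k : ℕ) (a : ℤ × ℤ) : (nb2 k a).card = (2 * k + 1) ^ 2 := by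
  unfold nb2; rw [Finset.card_product, nb1_card, nb1_card, sq]

lemma nb1_symm (k : ℕ) (a b : ℤ) (h : b ∈ nb1 k a) : a ∈ nb1 k b := by
  unfold nb1 at *; rw [Finset.mem_Icc] at *; omega

lemma nb2_symm (k : ℕ) (a b : ℤ × ℤ) (h : b ∈ nb2 k a) : a ∈ nb2 k b := by
  unfold nb2 at *
  rw [Finset.mem_product] at *
  exact ⟨nb1_symm _ _ _ h.1, nb1_symm _ _ _ h.2⟩

lemma cell1_H1 {δ : ℝ} (hδ : 0 < δ) {x y : ℝ} (h : cell1 δ x = cell1 δ y) : dist x y < δ := by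
  unfold cell1 at h
  have := Int.abs_sub_lt_one_of_floor_eq_floor h
  rw [← sub_div, abs_div, abs_of_pos hδ, div_lt_one hδ] at this
  exact this

lemma cell1_H2 {δ : ℝ} (hδ : 0 < δ) (k : ℕ) {x y : ℝ} (h : dist x y < k * δ) :
    cell1 δ y ∈ nb1 k (cell1 δ x) := by
  have h2 : |x / δ - y / δ| < k := by
    rw [← sub_div, abs_div, abs_of_pos hδ, div_lt_iff₀ hδ]; exact h
  rw [abs_lt] at h2
  unfold nb1 cell1
  rw [Finset.mem_Icc]
  have a1 := Int.floor_le (x / δ)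
  have a2 := Int.lt_floor_add_one (x / δ)
  have a3 := Int.floor_le (y / δ)
  have a4 := Int.lt_floor_add_one (y / δ)
  constructor
  · have : ((⌊x / δ⌋ - k : ℤ) : ℝ) < (⌊y / δ⌋ + 1 : ℤ) := by push_cast; linarith
    have := Int.cast_lt.1 this; omega
  · have : ((⌊y / δ⌋ : ℤ) : ℝ) < (⌊x / δ⌋ + k + 1 : ℤ) := by push_cast; linarith
    have := Int.cast_lt.1 this; omega

lemma cell2_H1 {δ : ℝ} (hδ : 0 < δ) {x y : ℝ × ℝ} (h : cell2 δ x = cell2 δ y) : dist x y < δ := by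
  unfold cell2 at h
  rw [Prod.mk.injEq] at h
  exact max_lt (cell1_H1 hδ h.1) (cell1_H1 hδ h.2)

lemma cell2_H2 {δ : ℝ} (hδ : 0 < δ) (k : ℕ) {x y : ℝ × ℝ} (h : dist x y < k * δ) :
    cell2 δ y ∈ nb2 k (cell2 δ x) := by
  rw [Prod.dist_eq, max_lt_iff] at h
  exact Finset.mem_product.2 ⟨cell1_H2 hδ k h.1, cell1_H2 hδ k h.2⟩

lemma cell1_meas (δ : ℝ) : Measurable (cell1 δ) := by
  unfold cell1; exact Int.measurable_floor.comp (measurable_id.div_const δ)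

lemma cell2_meas (δ : ℝ) : Measurable (cell2 δ) := by
  unfold cell2
  exact ((cell1_meas δ).comp measurable_fst).prodMk ((cell1_meas δ).comp measurable_snd)

lemma S_inj {B : IFSData ι} (hc : ∀ i, 0 < B.c i) (hd : ∀ i, 0 < B.d i) (i : ι) :
    Function.Injective (B.S i) := by
  intro x y h
  obtain ⟨e1, e2⟩ := Sw_dist hc hd [i] x y
  rw [Sw_singleton, h] at e1 e2
  obtain ⟨g1, g2⟩ := dims_pos hc hd [i]
  simp only [dist_self, zero_eq_mul, g1.ne', g2.ne', false_or] at e1 e2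
  split_ifs at e1 e2
  · exact Prod.ext (dist_eq_zero.1 e2) (dist_eq_zero.1 e1)
  · exact Prod.ext (dist_eq_zero.1 e1) (dist_eq_zero.1 e2)

lemma affine_1d {σ d t a b : ℝ} (hσ : σ = 1 ∨ σ = -1) (hd : 0 < d) :
    ∃ u, (∀ x ∈ Icc a b, σ * (d * x) + t ∈ Icc u (u + d * (b - a))) ∧
      ∀ v ∈ Ioo u (u + d * (b - a)), ∃ x ∈ Ioo a b, σ * (d * x) + t = v := by
  rcases hσ with rfl | rfl
  · refine ⟨d * a + t, fun x hx => ?_, fun v hv => ⟨(v - t) / d, ?_, ?_⟩⟩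
    · constructor <;> nlinarith [hx.1, hx.2]
    · constructor
      · rw [lt_div_iff₀ hd]; nlinarith [hv.1]
      · rw [div_lt_iff₀ hd]; nlinarith [hv.2]
    · field_simp; ring
  · refine ⟨-(d * b) + t, fun x hx => ?_, fun v hv => ⟨(t - v) / d, ?_, ?_⟩⟩
    · constructor <;> nlinarith [hx.1, hx.2]
    · constructor
      · rw [lt_div_iff₀ hd]; nlinarith [hv.2]
      · rw [div_lt_iff₀ hd]; nlinarith [hv.1]
    · field_simp; ring

lemma box_form' {B : IFSData ι} (hc : ∀ i, 0 < B.c i) (hd : ∀ i, 0 < B.d i)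
    {x₁ x₂ y₁ y₂ w0 : ℝ} (hw : 0 ≤ w0) (h1 : w0 ≤ x₂ - x₁) (h2 : w0 ≤ y₂ - y₁) (l : List ι) :
    ∃ a b L1 L2, B.alpha2 l * w0 ≤ L1 ∧ B.alpha2 l * w0 ≤ L2 ∧
      (∀ x ∈ Icc x₁ x₂ ×ˢ Icc y₁ y₂, B.Sw l x ∈ Icc a (a + L1) ×ˢ Icc b (b + L2)) ∧
      Ioo a (a + L1) ×ˢ Ioo b (b + L2) ⊆ B.Sw l '' (Ioo x₁ x₂ ×ˢ Ioo y₁ y₂) := by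
  obtain ⟨σ₁, σ₂, t₁, t₂, s1, s2, h⟩ := Sw_form B l
  obtain ⟨g1, g2⟩ := dims_pos hc hd l
  have m1 : B.alpha2 l ≤ (B.dims l).1 := min_le_left _ _
  have m2 : B.alpha2 l ≤ (B.dims l).2 := min_le_right _ _
  cases hs : B.swapW l
  · obtain ⟨u, hu1, hu2⟩ := affine_1d (t := t₁) (a := x₁) (b := x₂) s1 g1
    obtain ⟨v, hv1, hv2⟩ := affine_1d (t := t₂) (a := y₁) (b := y₂) s2 g2
    simp only [hs] at h
    refine ⟨u, v, _, _, mul_le_mul m1 h1 hw g1.le, mul_le_mul m2 h2 hw g2.le, ?_, ?_⟩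
    · rintro x ⟨hx1, hx2⟩
      rw [h x]; exact ⟨hu1 _ hx1, hv1 _ hx2⟩
    · rintro ⟨z1, z2⟩ ⟨hz1, hz2⟩
      obtain ⟨x, hx, ex⟩ := hu2 _ hz1
      obtain ⟨y, hy, ey⟩ := hv2 _ hz2
      refine ⟨(x, y), ⟨hx, hy⟩, ?_⟩
      rw [h]; exact Prod.ext ex ey
  · obtain ⟨u, hu1, hu2⟩ := affine_1d (t := t₁) (a := y₁) (b := y₂) s1 g1
    obtain ⟨v, hv1, hv2⟩ := affine_1d (t := t₂) (a := x₁) (b := x₂) s2 g2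
    simp only [hs] at h
    refine ⟨u, v, _, _, mul_le_mul m1 h2 hw g1.le, mul_le_mul m2 h1 hw g2.le, ?_, ?_⟩
    · rintro x ⟨hx1, hx2⟩
      rw [h x]; exact ⟨hu1 _ hx2, hv1 _ hx1⟩
    · rintro ⟨z1, z2⟩ ⟨hz1, hz2⟩
      obtain ⟨x, hx, ex⟩ := hu2 _ hz1
      obtain ⟨y, hy, ey⟩ := hv2 _ hz2
      refine ⟨(y, x), ⟨hy, hx⟩, ?_⟩
      rw [h]; exact Prod.ext ex ey

lemma grid_1d {a L z s : ℝ} (hs : 0 < s) (hL : s ≤ L) (hz : z ∈ Icc a (a + L)) :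
    ∃ j : ℤ, (j : ℝ) * (s / 2) ∈ Ioo a (a + L) ∧ |(j : ℝ) * (s / 2) - z| < s := by
  set u := min z (a + L - s) with hu
  have u1 : a ≤ u := le_min hz.1 (by linarith)
  have u2 : u ≤ z := min_le_left _ _
  have u3 : u ≤ a + L - s := min_le_right _ _
  have u4 : z ≤ u + s := by
    rcases min_choice z (a + L - s) with h | h
    · rw [hu, h]; linarith
    · rw [hu, h]; linarith [hz.2]
  have hs2 : 0 < s / 2 := by positivity
  have f1 := Int.floor_le (u / (s / 2))
  have f2 := Int.lt_floor_add_one (u / (s / 2))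
  rw [le_div_iff₀ hs2] at f1
  rw [div_lt_iff₀ hs2] at f2
  refine ⟨⌊u / (s / 2)⌋ + 1, ⟨?_, ?_⟩, ?_⟩
  · push_cast; linarith
  · push_cast; linarith
  · push_cast; rw [abs_lt]; constructor <;> linarith

section good
variable [Fintype ι] {B : IFSData ι} {p : ι → ℝ} {μ : Measure (ℝ × ℝ)}
  {m M pm x₁ x₂ y₁ y₂ : ℝ}

lemma Good.disjW (G : Good B p μ m M pm x₁ x₂ y₁ y₂) : ∀ l l' : List ι,
    ¬ l <+: l' → ¬ l' <+: l → Disjoint (B.Sw l '' (Set.Ioo x₁ x₂ ×ˢ Set.Ioo y₁ y₂))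
      (B.Sw l' '' (Set.Ioo x₁ x₂ ×ˢ Set.Ioo y₁ y₂)) := by
  intro l
  induction l with
  | nil => intro l' h; exact absurd List.nil_prefix h
  | cons i t ih =>
    intro l' h h'
    cases l' with
    | nil => exact absurd List.nil_prefix h'
    | cons j t' =>
      rw [Sw_cons, Sw_cons, image_comp, image_comp]
      by_cases hij : i = j
      · subst hij
        refine disjoint_image_of_injective (S_inj G.hc G.hd i) (ih t' ?_ ?_)
        · exact fun hh => h (by simpa using hh)
        · exact fun hh => h' (by simpa using hh)
      · refine (G.disj hij).mono ?_ ?_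
        · exact image_mono (G.Sw_R t).image_subset
        · exact image_mono (G.Sw_R t').image_subset

/-- The number of cylinders meeting a given cell is bounded. -/
lemma Good.count (G : Good B p μ m M pm x₁ x₂ y₁ y₂) : ∃ N0 : ℕ, ∀ (δ : ℝ), 0 < δ →
    ∀ (C : Finset (List ι)), (∀ w ∈ C, ∀ w' ∈ C, w <+: w' → w = w') →
    (∀ w ∈ C, m * δ ≤ B.alpha2 w) → ∀ Q : ℤ × ℤ,
    (C.filter fun w => ∃ x ∈ Icc x₁ x₂ ×ˢ Icc y₁ y₂, cell2 δ (B.Sw w x) = Q).card ≤ N0 := by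
  set w0 := min (x₂ - x₁) (y₂ - y₁) with hw0
  have hw : 0 < w0 := lt_min (by linarith [G.hx]) (by linarith [G.hy])
  have hm := G.m0
  set κ := m * w0 / 2 with hκ
  have hκ0 : 0 < κ := by positivity
  refine ⟨(⌈1 / κ⌉₊ + 8) ^ 2, fun δ hδ C hanti hC Q => ?_⟩
  let T : ℤ → Finset ℤ := fun a => Finset.Icc ⌊((a : ℝ) - 2 * κ) / κ⌋ ⌈((a : ℝ) + 1 + 2 * κ) / κ⌉
  have hT : ∀ a, (T a).card ≤ ⌈1 / κ⌉₊ + 8 := by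
    intro a
    simp only [T]
    rw [Int.card_Icc, Int.toNat_le]
    have f1 := Int.sub_one_lt_floor (((a : ℝ) - 2 * κ) / κ)
    have f2 := Int.ceil_lt_add_one (((a : ℝ) + 1 + 2 * κ) / κ)
    have f3 : 1 / κ ≤ (⌈1 / κ⌉₊ : ℝ) := Nat.le_ceil _
    have e1 : ((a : ℝ) + 1 + 2 * κ) / κ = ((a : ℝ) - 2 * κ) / κ + 1 / κ + 4 := by
      field_simp; ring
    have : ((⌈((a : ℝ) + 1 + 2 * κ) / κ⌉ + 1 - ⌊((a : ℝ) - 2 * κ) / κ⌋ : ℤ) : ℝ) ≤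
        ((⌈1 / κ⌉₊ + 8 : ℕ) : ℤ) := by
      push_cast
      linarith
    exact_mod_cast this
  have hs : 0 < δ * κ * 2 := by positivity
  have hTm : ∀ (a j : ℤ) (z : ℝ), cell1 δ z = a → |(j : ℝ) * (δ * κ * 2 / 2) - z| < δ * κ * 2 →
      j ∈ T a := by
    intro a j z hz hj
    unfold cell1 at hz
    rw [Int.floor_eq_iff, le_div_iff₀ hδ, div_lt_iff₀ hδ] at hz
    rw [abs_lt] at hj
    simp only [T, Finset.mem_Icc]
    constructor
    · have : ((a : ℝ) - 2 * κ) / κ ≤ j := by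
        rw [div_le_iff₀ hκ0]
        nlinarith [hz.1, hz.2, hj.1, hj.2]
      have := (Int.floor_le _).trans this
      exact_mod_cast this
    · have : (j : ℝ) ≤ ((a : ℝ) + 1 + 2 * κ) / κ := by
        rw [le_div_iff₀ hκ0]
        nlinarith [hz.1, hz.2, hj.1, hj.2]
      have := this.trans (Int.le_ceil _)
      exact_mod_cast this
  have key : ∀ w ∈ C.filter fun w => ∃ x ∈ Icc x₁ x₂ ×ˢ Icc y₁ y₂, cell2 δ (B.Sw w x) = Q,
      ∃ j : ℤ × ℤ, j ∈ T Q.1 ×ˢ T Q.2 ∧ ((j.1 : ℝ) * (δ * κ * 2 / 2), (j.2 : ℝ) * (δ * κ * 2 / 2)) ∈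
        B.Sw w '' (Set.Ioo x₁ x₂ ×ˢ Set.Ioo y₁ y₂) := by
    intro w hwC
    rw [Finset.mem_filter] at hwC
    obtain ⟨hwC, x, hx, rfl⟩ := hwC
    obtain ⟨a, b, L1, L2, h1, h2, h3, h4⟩ := box_form' G.hc G.hd hw.le
      (min_le_left (x₂ - x₁) (y₂ - y₁)) (min_le_right _ _) w
    have hk : δ * κ * 2 ≤ B.alpha2 w * w0 := by
      have := hC w hwC
      rw [hκ]; nlinarith
    obtain ⟨hx1, hx2⟩ := h3 x hx
    obtain ⟨j, j1, j2⟩ := grid_1d hs (hk.trans h1) hx1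
    obtain ⟨k, k1, k2⟩ := grid_1d hs (hk.trans h2) hx2
    refine ⟨(j, k), Finset.mem_product.2 ⟨hTm _ j _ rfl j2, hTm _ k _ rfl k2⟩, h4 ⟨j1, k1⟩⟩
  choose! φ hφ1 hφ2 using key
  refine (Finset.card_le_card_of_injOn φ hφ1 ?_).trans ?_
  · intro w hw w' hw' e
    have c1 := (Finset.mem_filter.1 hw).1
    have c2 := (Finset.mem_filter.1 hw').1
    by_contra hne
    have hd := G.disjW w w' (fun h => hne (hanti w c1 w' c2 h))
      (fun h => hne (hanti w' c2 w c1 h).symm)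
    have h1 := hφ2 w hw
    have h2 := hφ2 w' hw'
    rw [← e] at h2
    exact Set.disjoint_left.1 hd h1 h2
  · rw [Finset.card_product, sq]
    exact Nat.mul_le_mul (hT _) (hT _)

end good

lemma proj_dist {B : IFSData ι} (hc : ∀ i, 0 < B.c i) (hd : ∀ i, 0 < B.d i) (l : List ι)
    (x y : ℝ × ℝ) :
    B.alpha1 l * dist (B.projW l x) (B.projW l y) ≤ dist (B.Sw l x) (B.Sw l y) ∧
    dist (B.Sw l x) (B.Sw l y) ≤ max (B.alpha1 l * dist (B.projW l x) (B.projW l y))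
      (B.alpha2 l * dist x y) := by
  obtain ⟨e1, e2⟩ := Sw_dist hc hd l x y
  obtain ⟨g1, g2⟩ := dims_pos hc hd l
  have d1 : dist x.1 y.1 ≤ dist x y := le_max_left _ _
  have d2 : dist x.2 y.2 ≤ dist x y := le_max_right _ _
  rw [Prod.dist_eq (x := B.Sw l x), e1, e2]
  unfold IFSData.projW IFSData.usesPi1 IFSData.alpha1 IFSData.alpha2
  cases hs : B.swapW l <;> rcases le_or_gt (B.dims l).2 (B.dims l).1 with h | h
  · simp only [h, max_eq_left, min_eq_right, and_self, true_or, if_true, Bool.false_eq_true, if_false]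
    exact ⟨le_max_left _ _, max_le_max le_rfl (by gcongr)⟩
  · have h' := not_le.2 h
    simp only [h', max_eq_right h.le, min_eq_left h.le, and_false, false_and, or_self, Bool.false_eq_true, if_false]
    exact ⟨le_max_right _ _, max_le (le_max_of_le_right (by gcongr)) (le_max_left _ _)⟩
  · have h' := not_lt.2 h
    simp only [h', max_eq_left h, min_eq_right h, and_false, false_and, or_self, if_false, if_true, Bool.true_eq_false]
    exact ⟨le_max_left _ _, max_le_max le_rfl (by gcongr)⟩
  · simp only [h, max_eq_right h.le, min_eq_left h.le, and_self, or_true, if_true]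
    exact ⟨le_max_right _ _, max_le (le_max_of_le_right (by gcongr)) (le_max_left _ _)⟩

end geometry

section compare
variable {ι : Type} [Fintype ι] {B : IFSData ι} {p : ι → ℝ} {μ : Measure (ℝ × ℝ)}
  {m M pm x₁ x₂ y₁ y₂ : ℝ}

lemma tsum_prod_unc {A A' : Type*} (F : A × A' → ENNReal) :
    ∑' b, F b = ∑' a, ∑' a', F (a, a') := ENNReal.tsum_prod (f := fun a a' => F (a, a'))

lemma projW_meas (B : IFSData ι) (l : List ι) : Measurable (B.projW l) := by
  unfold IFSData.projW
  split_ifs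
  exacts [measurable_fst, measurable_snd]

lemma Good.compare (G : Good B p μ m M pm x₁ x₂ y₁ y₂) [IsProbabilityMeasure μ] :
    ∃ K1 K2 : ℕ, ∀ (δ : ℝ), 0 < δ → ∀ (st : List ι → Prop) (n : ℕ),
    (∀ w ∈ cut st n [], m * δ ≤ B.alpha2 w ∧ B.alpha2 w < δ) → ∀ q, 0 ≤ q →
    DD μ (cell2 δ) q ≤ (K1 : ENNReal) ^ q * K2 * ∑ w ∈ cut st n [],
      GG q (ENNReal.ofReal (wordProb p w)) *
        DD (Measure.map (B.projW w) μ) (cell1 (δ / B.alpha1 w)) q ∧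
    ∑ w ∈ cut st n [], GG q (ENNReal.ofReal (wordProb p w)) *
        DD (Measure.map (B.projW w) μ) (cell1 (δ / B.alpha1 w)) q ≤
      (K2 : ENNReal) ^ q * K1 * DD μ (cell2 δ) q := by
  obtain ⟨N0, hN0⟩ := G.count
  set R := Icc x₁ x₂ ×ˢ Icc y₁ y₂ with hR
  set D := max (x₂ - x₁) (y₂ - y₁) with hD
  have hDpos : 0 < D := lt_max_of_lt_left (by linarith [G.hx])
  have hdR : ∀ x ∈ R, ∀ y ∈ R, dist x y ≤ D := by
    rintro ⟨a, b⟩ ⟨ha, hb⟩ ⟨a', b'⟩ ⟨ha', hb'⟩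
    rw [Prod.dist_eq]
    exact max_le_max (Real.dist_le_of_mem_Icc ha ha') (Real.dist_le_of_mem_Icc hb hb')
  set k := ⌈D⌉₊ + 1 with hk
  refine ⟨N0 * 3, (2 * k + 1) ^ 2, fun δ hδ st n hC q hq => ?_⟩
  set C := cut st n [] with hCdef
  have ha1 : ∀ l : List ι, 0 < B.alpha1 l := fun l => lt_max_of_lt_left (dims_pos G.hc G.hd l).1
  have hr : ∀ l : List ι, 0 < δ / B.alpha1 l := fun l => div_pos hδ (ha1 l)
  let g : List ι → ℝ × ℝ → ℤ := fun l x => cell1 (δ / B.alpha1 l) (B.projW l x)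
  let f : List ι → ℝ × ℝ → ℤ × ℤ := fun l x => cell2 δ (B.Sw l x)
  have hg : ∀ l, Measurable (g l) := fun l => (cell1_meas _).comp (projW_meas B l)
  have hf : ∀ l, Measurable (f l) := fun l => (cell2_meas _).comp (Sw_cont B l).measurable
  have hgm : ∀ l a, MeasurableSet (g l ⁻¹' {a}) := fun l a => hg l (measurableSet_singleton a)
  have hfm : ∀ l a, MeasurableSet (f l ⁻¹' {a}) := fun l a => hf l (measurableSet_singleton a)
  let W : ℤ × ℤ → (C × ℤ) → ENNReal := fun Q b =>
    ENNReal.ofReal (wordProb p b.1) * μ (f b.1 ⁻¹' {Q} ∩ g b.1 ⁻¹' {b.2})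
  have k1 : ∀ Q, ∑' b, W Q b = μ (cell2 δ ⁻¹' {Q}) := by
    intro Q
    rw [tsum_prod_unc, tsum_fintype, G.cut_apply st n (cell2_meas δ (measurableSet_singleton Q))]
    refine Eq.trans ?_ (Finset.sum_coe_sort C (fun w => ENNReal.ofReal (wordProb p w) *
      μ (B.Sw w ⁻¹' (cell2 δ ⁻¹' {Q}))))
    refine Finset.sum_congr rfl fun l _ => ?_
    simp only [W]
    rw [ENNReal.tsum_mul_left, ← meas_fibre_sum μ (g l) (hgm l)]
    rfl
  have k2 : ∀ b : C × ℤ, ∑' Q, W Q b = ENNReal.ofReal (wordProb p b.1) *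
      (Measure.map (B.projW b.1) μ) (cell1 (δ / B.alpha1 b.1) ⁻¹' {b.2}) := by
    intro b
    simp only [W]
    rw [ENNReal.tsum_mul_left, Measure.map_apply (projW_meas B _)
      (cell1_meas _ (measurableSet_singleton _))]
    congr 1
    rw [meas_fibre_sum μ (f b.1) (hfm b.1)]
    congr 1; ext Q; rw [inter_comm]; rfl
  have hz : ∀ Q b, (∀ x ∈ R, ¬ (f b.1 x = Q ∧ g b.1 x = b.2)) → W Q b = 0 := by
    intro Q b h
    have : μ (f b.1 ⁻¹' {Q} ∩ g b.1 ⁻¹' {b.2}) = 0 := by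
      refine measure_mono_null (t := Rᶜ) ?_ G.supp
      exact fun x hx hxR => h x hxR hx
    simp only [W, this, mul_zero]
  have fin1 : ∀ Q, ∑' b, W Q b ≠ ⊤ := fun Q => by rw [k1]; exact measure_ne_top _ _
  have fin2 : ∀ b, ∑' Q, W Q b ≠ ⊤ := fun b => by
    rw [k2]
    have : IsProbabilityMeasure (Measure.map (B.projW b.1) μ) :=
      Measure.isProbabilityMeasure_map (projW_meas B _).aemeasurable
    exact ENNReal.mul_ne_top ENNReal.ofReal_ne_top (measure_ne_top _ _)
  have c1 : ∀ Q, ∃ s : Finset (C × ℤ), s.card ≤ N0 * 3 ∧ ∀ b ∉ s, W Q b = 0 := by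
    intro Q
    have hcount := hN0 δ hδ C (fun w hw w' hw' => cut_antichain hw hw') (fun w hw => (hC w hw).1) Q
    set F := C.filter fun w => ∃ x ∈ R, cell2 δ (B.Sw w x) = Q with hF
    have : ∀ w : C, ∃ a : ℤ, ∀ x ∈ R, f w x = Q → g w x ∈ nb1 1 a := by
      intro w
      by_cases hw : ∃ x ∈ R, f w x = Q
      · obtain ⟨x, hx, e⟩ := hw
        refine ⟨g w x, fun y hy e' => cell1_H2 (hr _) 1 ?_⟩
        have h1 := cell2_H1 hδ (e.trans e'.symm)
        have h2 := (proj_dist G.hc G.hd w x y).1.trans_lt h1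
        rw [Nat.cast_one, one_mul, lt_div_iff₀ (ha1 _), mul_comm]
        exact h2
      · exact ⟨0, fun x hx e => absurd ⟨x, hx, e⟩ hw⟩
    choose a ha using this
    let F' : Finset C := Finset.univ.filter fun w : C => (w : List ι) ∈ F
    have hF' : F'.card ≤ N0 := by
      refine le_trans ?_ hcount
      refine Finset.card_le_card_of_injOn (fun w : C => (w : List ι)) ?_ ?_
      · intro w hw; exact (Finset.mem_filter.1 hw).2
      · intro w _ w' _ h; exact Subtype.ext h
    refine ⟨F'.biUnion fun w => (nb1 1 (a w)).image (fun z => (w, z)), ?_, ?_⟩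
    · refine (Finset.card_biUnion_le_card_mul _ _ 3 fun w _ => ?_).trans (Nat.mul_le_mul_right 3 hF')
      exact Finset.card_image_le.trans (by rw [nb1_card])
    · rintro ⟨w, z⟩ hb
      refine hz Q _ fun x hx he => hb ?_
      simp only at he
      simp only [Finset.mem_biUnion, Finset.mem_image]
      refine ⟨w, ?_, z, ?_, rfl⟩
      · exact Finset.mem_filter.2 ⟨Finset.mem_univ _, Finset.mem_filter.2 ⟨w.2, x, hx, he.1⟩⟩
      · rw [← he.2]; exact ha w x hx he.1
  have c2 : ∀ b, ∃ s : Finset (ℤ × ℤ), s.card ≤ (2 * k + 1) ^ 2 ∧ ∀ Q ∉ s, W Q b = 0 := by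
    intro b
    by_cases hb : ∃ x ∈ R, g b.1 x = b.2
    · obtain ⟨x, hx, e⟩ := hb
      refine ⟨nb2 k (f b.1 x), (nb2_card _ _).le, fun Q hQ => hz Q b fun y hy he => hQ ?_⟩
      rw [← he.1]
      refine cell2_H2 hδ k ?_
      have h1 := cell1_H1 (hr _) (e.trans he.2.symm)
      rw [lt_div_iff₀ (ha1 _), mul_comm] at h1
      refine (proj_dist G.hc G.hd b.1 x y).2.trans_lt (max_lt ?_ ?_)
      · refine h1.trans_le (le_mul_of_one_le_left hδ.le ?_)
        rw [hk]; push_cast; linarith [Nat.cast_nonneg (α := ℝ) ⌈D⌉₊]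
      · have h2 := (hC b.1 b.1.2).2
        have h3 := hdR x hx y hy
        have h4 : D ≤ ⌈D⌉₊ := Nat.le_ceil _
        have h5 : B.alpha2 b.1 * dist x y ≤ δ * D := mul_le_mul h2.le h3 dist_nonneg hδ.le
        refine h5.trans_lt ?_
        rw [hk, mul_comm]; push_cast
        exact mul_lt_mul_of_pos_right (by linarith) hδ
    · exact ⟨∅, by simp, fun Q _ => hz Q b fun x hx he => hb ⟨x, hx, he.2⟩⟩
  have eA : ∑' Q, GG q (∑' b, W Q b) = DD μ (cell2 δ) q := by simp_rw [k1]; rfl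
  have eB : ∑' b, GG q (∑' Q, W Q b) = ∑ w ∈ C, GG q (ENNReal.ofReal (wordProb p w)) *
        DD (Measure.map (B.projW w) μ) (cell1 (δ / B.alpha1 w)) q := by
    simp_rw [k2]
    rw [tsum_prod_unc, tsum_fintype]
    refine Eq.trans ?_ (Finset.sum_coe_sort C (fun w => GG q (ENNReal.ofReal (wordProb p w)) *
        DD (Measure.map (B.projW w) μ) (cell1 (δ / B.alpha1 w)) q))
    refine Finset.sum_congr rfl fun l _ => ?_
    have : IsProbabilityMeasure (Measure.map (B.projW l) μ) :=
      Measure.isProbabilityMeasure_map (projW_meas B _).aemeasurable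
    unfold DD
    rw [← ENNReal.tsum_mul_left]
    congr 1; ext z
    rw [GG_mul ENNReal.ofReal_ne_top (measure_ne_top _ _)]
  rw [← eA, ← eB]
  exact ⟨CL W hq _ _ fin1 fin2 c1 c2, CL (fun b Q => W Q b) hq _ _ fin2 fin1 c2 c1⟩

end compare

section proj

lemma rpow_bdd {a b : ℝ} (ha : 0 < a) (e : ℝ) :
    ∃ K : ℝ, 0 < K ∧ ∀ r, a ≤ r → r ≤ b → r ^ e ≤ K := by
  rcases le_total 0 e with he | he
  · refine ⟨max b 1 ^ e, by positivity, fun r h1 h2 => ?_⟩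
    exact Real.rpow_le_rpow (ha.le.trans h1) (h2.trans (le_max_left _ _)) he
  · refine ⟨a ^ e, by positivity, fun r h1 h2 => ?_⟩
    exact Real.rpow_le_rpow_of_nonpos ha h1 he

lemma cell_count {a b r : ℝ} (hr : 0 < r) (k : ℕ) (hk : b - a < k * r) :
    ∃ s : Finset ℤ, s.card ≤ 2 * k + 1 ∧ ∀ x ∈ Icc a b, cell1 r x ∈ s := by
  refine ⟨nb1 k (cell1 r a), (nb1_card _ _).le, fun x hx => cell1_H2 hr k ?_⟩
  rw [dist_comm, Real.dist_eq, abs_of_nonneg (by linarith [hx.1])]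
  linarith [hx.2]

lemma natCast_rpow_ofReal (M : ℕ) {q : ℝ} (hq : 0 ≤ q) :
    (M : ENNReal) ^ q = ENNReal.ofReal ((M : ℝ) ^ q) := by
  rw [← ENNReal.ofReal_rpow_of_nonneg (Nat.cast_nonneg _) hq, ENNReal.ofReal_natCast]

lemma proj_PolyB (ν : Measure ℝ) [IsProbabilityMeasure ν] {a b : ℝ} (hE : ν (Icc a b)ᶜ = 0)
    (hab : a < b) {q : ℝ} (hq : 0 ≤ q) : PolyB (fun δ => DD ν (cell1 δ) q) := by
  set L := 2 * (b - a) + 3 with hL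
  have hL0 : 1 ≤ L := by linarith
  refine ⟨L ^ (1 + q), 1 + q, by positivity, ?_⟩
  filter_upwards [small_pos] with δ hδ
  obtain ⟨h0, h1⟩ := hδ
  set k := ⌊(b - a) / δ⌋₊ + 1 with hk
  have hk1 : b - a < k * δ := by
    rw [← div_lt_iff₀ h0, hk]; push_cast; exact Nat.lt_floor_add_one _
  have hkL : ((2 * k + 1 : ℕ) : ℝ) ≤ L / δ := by
    rw [le_div_iff₀ h0, hk]
    have : (⌊(b - a) / δ⌋₊ : ℝ) ≤ (b - a) / δ := Nat.floor_le (div_nonneg (by linarith) h0.le)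
    rw [le_div_iff₀ h0] at this
    push_cast; nlinarith
  have hLd : 1 ≤ L / δ := by rw [le_div_iff₀ h0]; linarith
  obtain ⟨u, l⟩ := DD_triv ν (cell1 δ) (fun a => cell1_meas δ (measurableSet_singleton a)) _ hE hq
    (2 * k + 1) (cell_count h0 k hk1)
  have e : L ^ (1 + q) * δ ^ (-(1 + q)) = (L / δ) ^ (1 + q) := by
    rw [Real.div_rpow (by linarith) h0.le, Real.rpow_neg h0.le]; rfl
  constructor
  · have : ENNReal.ofReal 1 ≤ ENNReal.ofReal ((L / δ) ^ (1 + q)) * DD ν (cell1 δ) q := by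
      rw [ENNReal.ofReal_one]
      refine l.trans ?_
      gcongr
      rw [natCast_rpow_ofReal _ hq]
      refine ENNReal.ofReal_le_ofReal ((Real.rpow_le_rpow (by positivity) hkL hq).trans ?_)
      exact Real.rpow_le_rpow_of_exponent_le hLd (by linarith)
    have h2 := ofReal_div_le (by positivity) this
    rw [← e] at h2
    refine le_trans (le_of_eq ?_) h2
    congr 1
    rw [Real.rpow_neg h0.le]; field_simp
  · rw [e]
    refine u.trans ?_
    rw [← ENNReal.ofReal_natCast]
    refine ENNReal.ofReal_le_ofReal (hkL.trans ?_)
    conv_lhs => rw [← Real.rpow_one (L / δ)]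
    exact Real.rpow_le_rpow_of_exponent_le hLd (by linarith)

lemma cell1_equiv (ν : Measure ℝ) [IsProbabilityMeasure ν] (hlow : PolyLow ν) {q : ℝ}
    (hq : 0 ≤ q) : SubLE (JJ ν q) (fun δ => DD ν (cell1 δ) q) ∧
      SubLE (fun δ => DD ν (cell1 δ) q) (JJ ν q) :=
  JD_equiv ν cell1 (fun δ a => cell1_meas δ (measurableSet_singleton a)) nb1 (fun k => 2 * k + 1)
    nb1_symm (fun k a => (nb1_card k a).le) (fun _ h _ _ => cell1_H1 h)
    (fun _ h k _ _ => cell1_H2 h k) hlow hq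

lemma cell2_equiv (ν : Measure (ℝ × ℝ)) [IsProbabilityMeasure ν] (hlow : PolyLow ν) {q : ℝ}
    (hq : 0 ≤ q) : SubLE (JJ ν q) (fun δ => DD ν (cell2 δ) q) ∧
      SubLE (fun δ => DD ν (cell2 δ) q) (JJ ν q) :=
  JD_equiv ν cell2 (fun δ a => cell2_meas δ (measurableSet_singleton a)) nb2
    (fun k => (2 * k + 1) ^ 2)
    nb2_symm (fun k a => (nb2_card k a).le) (fun _ h _ _ => cell2_H1 h)
    (fun _ h k _ _ => cell2_H2 h k) hlow hq

lemma proj_EX (ν : Measure ℝ) [IsProbabilityMeasure ν] {a b : ℝ} (hE : ν (Icc a b)ᶜ = 0)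
    (hab : a < b) (hlow : PolyLow ν) {q t : ℝ} (hq : 0 ≤ q) (h : IsLqSpec ν q t) :
    EX (fun δ => DD ν (cell1 δ) q) t := by
  obtain ⟨e1, e2⟩ := cell1_equiv ν hlow hq
  exact EX_congr e1 e2 (spec_to_EX ν hlow (PolyB_congr e2 e1 (proj_PolyB ν hE hab hq)) h)

lemma proj_all (ν : Measure ℝ) [IsProbabilityMeasure ν] {a b : ℝ} (hE : ν (Icc a b)ᶜ = 0)
    {q t : ℝ} (hq : 0 ≤ q) (h : EX (fun δ => DD ν (cell1 δ) q) t)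
    (Λ : ℝ) {ε : ℝ} (hε : 0 < ε) : ∃ C : ℝ, 0 < C ∧ ∀ r, 0 < r → r ≤ Λ →
      ENNReal.ofReal (C⁻¹ * r ^ (ε - t)) ≤ DD ν (cell1 r) q ∧
      DD ν (cell1 r) q ≤ ENNReal.ofReal (C * r ^ (-ε - t)) := by
  obtain ⟨C0, hC0, hev⟩ := h ε hε
  obtain ⟨r0, hr0, hev⟩ := mem_nhdsGT_iff_exists_Ioo_subset.1 hev
  have hr0 : 0 < r0 := hr0
  set k := ⌊(b - a) / r0⌋₊ + 1 with hk
  have hk1 : b - a < k * r0 := by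
    rw [← div_lt_iff₀ hr0, hk]; push_cast; exact Nat.lt_floor_add_one _
  obtain ⟨K1, hK1, b1⟩ := rpow_bdd (a := r0) (b := Λ) hr0 (ε - t)
  obtain ⟨K2, hK2, b2⟩ := rpow_bdd (a := r0) (b := Λ) hr0 (-(-ε - t))
  set M : ℝ := ((2 * k + 1 : ℕ) : ℝ) with hM
  have hM0 : 0 < M := by rw [hM]; positivity
  refine ⟨C0 + M * K2 + M ^ q * K1, by positivity, fun r h0 h1 => ?_⟩
  set C := C0 + M * K2 + M ^ q * K1 with hC
  have hCpos : 0 < C := by positivity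
  have hp1 : 0 < r ^ (ε - t) := Real.rpow_pos_of_pos h0 _
  have hp2 : 0 < r ^ (-ε - t) := Real.rpow_pos_of_pos h0 _
  by_cases hr : r < r0
  · obtain ⟨l, u⟩ := hev ⟨h0, hr⟩
    have : C0 ≤ C := by rw [hC]; have := mul_pos hM0 hK2; have : 0 < M ^ q * K1 := by positivity
                        linarith
    refine ⟨le_trans (ENNReal.ofReal_le_ofReal ?_) l, u.trans (ENNReal.ofReal_le_ofReal ?_)⟩
    · gcongr
    · gcongr
  · push Not at hr
    have hkr : b - a < k * r := hk1.trans_le (by gcongr)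
    obtain ⟨u, l⟩ := DD_triv ν (cell1 r) (fun a => cell1_meas r (measurableSet_singleton a)) _ hE hq
      (2 * k + 1) (cell_count h0 k hkr)
    constructor
    · rw [natCast_rpow_ofReal _ hq, ← ENNReal.ofReal_one] at l
      refine le_trans (ENNReal.ofReal_le_ofReal ?_) (ofReal_div_le (by positivity) l)
      rw [← hM, inv_mul_eq_div, div_le_div_iff₀ hCpos (by positivity), mul_comm, one_mul]
      have h3 := b1 r hr h1
      have h4 : M ^ q * r ^ (ε - t) ≤ M ^ q * K1 := by gcongr
      have := mul_pos hM0 hK2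
      linarith
    · refine u.trans ?_
      rw [← ENNReal.ofReal_natCast]
      refine ENNReal.ofReal_le_ofReal ?_
      have h3 := b2 r hr h1
      rw [Real.rpow_neg h0.le, inv_le_iff_one_le_mul₀ hp2] at h3
      have h4 : M * K2 ≤ C := by
        rw [hC]; have : 0 < M ^ q * K1 := by positivity
        linarith
      calc M ≤ M * (K2 * r ^ (-ε - t)) := le_mul_of_one_le_right hM0.le h3
        _ = M * K2 * r ^ (-ε - t) := by ring
        _ ≤ C * r ^ (-ε - t) := by gcongr

lemma swap_SubLE (ν ν' : Measure ℝ) [IsProbabilityMeasure ν] [IsProbabilityMeasure ν']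
    (A : ℝ → ℝ) (hA : Measurable A) {c : ℝ} (hc : 0 < c) (hc1 : c ≤ 1)
    (hd : ∀ x y, dist (A x) (A y) = c * dist x y) {π : ℝ} (hπ : 0 < π)
    (h : ∀ E, MeasurableSet E → ENNReal.ofReal π * ν (A ⁻¹' E) ≤ ν' E) {q : ℝ} (hq : 0 ≤ q) :
    SubLE (fun δ => DD ν (cell1 δ) q) (fun δ => DD ν' (cell1 δ) q) := by
  intro ε hε
  set k := ⌈1 / c⌉₊ with hk
  set K1 : ℕ := 2 * 1 + 1
  set K2 : ℕ := 2 * k + 1 with hK2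
  refine ⟨(K1 : ℝ) ^ q * K2 * (π ^ q)⁻¹, by positivity, ?_⟩
  filter_upwards [small_pos] with δ hδ
  obtain ⟨h0, h1⟩ := hδ
  have m1 : ∀ a, MeasurableSet (cell1 δ ⁻¹' {a}) := fun a => cell1_meas δ (measurableSet_singleton a)
  have m2 : ∀ a, MeasurableSet ((cell1 δ ∘ A) ⁻¹' {a}) :=
    fun a => ((cell1_meas δ).comp hA) (measurableSet_singleton a)
  have hdd := DD_comp ν (cell1 δ) (cell1 δ ∘ A) m1 m2 univ (by simp) hq K1 K2
    (by
      intro a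
      by_cases hx : ∃ x, cell1 δ x = a
      · obtain ⟨x, hx⟩ := hx
        refine ⟨nb1 1 (cell1 δ (A x)), (nb1_card _ _).le, fun y _ hy => cell1_H2 h0 1 ?_⟩
        have := cell1_H1 h0 (hx.trans hy.symm)
        rw [hd, Nat.cast_one, one_mul]
        exact (mul_le_of_le_one_left dist_nonneg hc1).trans_lt this
      · exact ⟨∅, by simp, fun y _ hy => absurd ⟨y, hy⟩ hx⟩)
    (by
      intro a
      by_cases hx : ∃ x, cell1 δ (A x) = a
      · obtain ⟨x, hx⟩ := hx
        refine ⟨nb1 k (cell1 δ x), (nb1_card _ _).le, fun y _ hy => cell1_H2 h0 k ?_⟩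
        have := cell1_H1 h0 (hx.trans hy.symm)
        rw [hd, mul_comm, ← lt_div_iff₀ hc] at this
        refine this.trans_le ?_
        rw [div_eq_mul_one_div, mul_comm]
        exact mul_le_mul_of_nonneg_right (Nat.le_ceil _) h0.le
      · exact ⟨∅, by simp, fun y _ hy => absurd ⟨y, hy⟩ hx⟩)
  have hg : GG q (ENNReal.ofReal π) = ENNReal.ofReal (π ^ q) := by
    rw [GG_eq (by simpa using hπ) ENNReal.ofReal_ne_top, ENNReal.ofReal_rpow_of_pos hπ]
  have h3 : ENNReal.ofReal (π ^ q) * DD ν (cell1 δ ∘ A) q ≤ DD ν' (cell1 δ) q := by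
    unfold DD
    rw [← hg, ← ENNReal.tsum_mul_left]
    refine ENNReal.tsum_le_tsum fun a => ?_
    rw [← GG_mul ENNReal.ofReal_ne_top (measure_ne_top _ _)]
    exact GG_mono hq (h _ (m1 a)) (measure_ne_top _ _)
  have h4 : DD ν (cell1 δ ∘ A) q ≤ ENNReal.ofReal ((π ^ q)⁻¹) * DD ν' (cell1 δ) q := by
    have hpq : 0 < π ^ q := Real.rpow_pos_of_pos hπ q
    calc DD ν (cell1 δ ∘ A) q
        = ENNReal.ofReal ((π ^ q)⁻¹) * (ENNReal.ofReal (π ^ q) * DD ν (cell1 δ ∘ A) q) := by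
          rw [← mul_assoc, ← ENNReal.ofReal_mul (by positivity), inv_mul_cancel₀ hpq.ne',
            ENNReal.ofReal_one, one_mul]
      _ ≤ _ := by gcongr
  refine hdd.trans ?_
  calc (K1 : ENNReal) ^ q * K2 * DD ν (cell1 δ ∘ A) q
      ≤ (K1 : ENNReal) ^ q * K2 * (ENNReal.ofReal ((π ^ q)⁻¹) * DD ν' (cell1 δ) q) := by gcongr
    _ = ENNReal.ofReal ((K1 : ℝ) ^ q * K2 * (π ^ q)⁻¹) * DD ν' (cell1 δ) q := by
        rw [natCast_rpow_ofReal _ hq, ← ENNReal.ofReal_natCast K2, ENNReal.ofReal_mul (by positivity),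
          ENNReal.ofReal_mul (by positivity), mul_assoc, mul_assoc, mul_assoc]
    _ ≤ _ := by
        refine mul_le_mul_left (ENNReal.ofReal_le_ofReal ?_) _
        refine le_mul_of_one_le_right (by positivity) ?_
        exact Real.one_le_rpow_of_pos_of_le_one_of_nonpos h0 h1.le (neg_nonpos.2 hε.le)

end proj

section final
variable {ι : Type} [Fintype ι] {B : IFSData ι} {p : ι → ℝ} {μ : Measure (ℝ × ℝ)}
  {m M pm x₁ x₂ y₁ y₂ : ℝ}

lemma Good.self_ge (G : Good B p μ m M pm x₁ x₂ y₁ y₂) (i : ι) {E : Set (ℝ × ℝ)}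
    (hE : MeasurableSet E) : ENNReal.ofReal (p i) * μ (B.S i ⁻¹' E) ≤ μ E := by
  conv_rhs => rw [G.self]
  rw [Measure.finset_sum_apply]
  refine le_trans (le_of_eq ?_) (Finset.single_le_sum
    (f := fun j => (ENNReal.ofReal (p j) • Measure.map (B.S j) μ) E)
    (fun _ _ => zero_le) (Finset.mem_univ i))
  rw [Measure.smul_apply, smul_eq_mul, Measure.map_apply (S_cont B i).measurable hE]

lemma Good.supp1 (G : Good B p μ m M pm x₁ x₂ y₁ y₂) :
    Measure.map Prod.fst μ (Icc x₁ x₂)ᶜ = 0 := by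
  rw [Measure.map_apply measurable_fst measurableSet_Icc.compl]
  exact measure_mono_null (t := (Icc x₁ x₂ ×ˢ Icc y₁ y₂)ᶜ) (fun x hx h => hx h.1) G.supp

lemma Good.supp2 (G : Good B p μ m M pm x₁ x₂ y₁ y₂) :
    Measure.map Prod.snd μ (Icc y₁ y₂)ᶜ = 0 := by
  rw [Measure.map_apply measurable_snd measurableSet_Icc.compl]
  exact measure_mono_null (t := (Icc x₁ x₂ ×ˢ Icc y₁ y₂)ᶜ) (fun x hx h => hx h.2) G.supp

lemma aff_dist {σ c t : ℝ} (hσ : σ = 1 ∨ σ = -1) (hc : 0 < c) (x y : ℝ) :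
    dist (σ * (c * x) + t) (σ * (c * y) + t) = c * dist x y := by
  rw [Real.dist_eq, Real.dist_eq, show σ * (c * x) + t - (σ * (c * y) + t) = σ * (c * (x - y)) by ring,
    abs_mul, abs_mul, abs_of_pos hc]
  rcases hσ with rfl | rfl <;> simp

lemma Good.HS (G : Good B p μ m M pm x₁ x₂ y₁ y₂) [IsProbabilityMeasure μ] {q t1 t2 : ℝ}
    (hq : 0 ≤ q) (h1 : EX (fun δ => DD (Measure.map Prod.fst μ) (cell1 δ) q) t1)
    (h2 : EX (fun δ => DD (Measure.map Prod.snd μ) (cell1 δ) q) t2) :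
    (∀ i, B.swap i = false) ∨ t1 = t2 := by
  by_cases hs : ∀ i, B.swap i = false
  · exact Or.inl hs
  right
  push Not at hs
  obtain ⟨i, hi⟩ := hs
  have hi : B.swap i = true := by simpa using hi
  have i1 : IsProbabilityMeasure (Measure.map Prod.fst μ) :=
    Measure.isProbabilityMeasure_map measurable_fst.aemeasurable
  have i2 : IsProbabilityMeasure (Measure.map Prod.snd μ) :=
    Measure.isProbabilityMeasure_map measurable_snd.aemeasurable
  have a1 : SubLE (fun δ => DD (Measure.map Prod.snd μ) (cell1 δ) q)
      (fun δ => DD (Measure.map Prod.fst μ) (cell1 δ) q) := by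
    have hmeas : Measurable fun x => (if B.sgn1 i then (1 : ℝ) else -1) * (B.c i * x) + (B.t i).1 := by
      fun_prop
    refine swap_SubLE _ _ (fun x => (if B.sgn1 i then (1 : ℝ) else -1) * (B.c i * x) + (B.t i).1)
      hmeas (G.hc i) ((G.cM i).trans G.M1.le)
      (aff_dist (by split_ifs <;> simp) (G.hc i)) (G.hp i) (fun E hE => ?_) hq
    rw [Measure.map_apply measurable_fst hE, Measure.map_apply measurable_snd (hmeas hE)]
    refine le_trans (le_of_eq ?_) (G.self_ge i (measurable_fst hE))
    congr 2
    ext x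
    simp [IFSData.S, hi]
  have a2 : SubLE (fun δ => DD (Measure.map Prod.fst μ) (cell1 δ) q)
      (fun δ => DD (Measure.map Prod.snd μ) (cell1 δ) q) := by
    have hmeas : Measurable fun x => (if B.sgn2 i then (1 : ℝ) else -1) * (B.d i * x) + (B.t i).2 := by
      fun_prop
    refine swap_SubLE _ _ (fun x => (if B.sgn2 i then (1 : ℝ) else -1) * (B.d i * x) + (B.t i).2)
      hmeas (G.hd i) ((G.dM i).trans G.M1.le)
      (aff_dist (by split_ifs <;> simp) (G.hd i)) (G.hp i) (fun E hE => ?_) hq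
    rw [Measure.map_apply measurable_snd hE, Measure.map_apply measurable_fst (hmeas hE)]
    refine le_trans (le_of_eq ?_) (G.self_ge i (measurable_snd hE))
    congr 2
    ext x
    simp [IFSData.S, hi]
  exact EX_unique (EX_congr a2 a1 h1) h2

lemma Good.proj_word (G : Good B p μ m M pm x₁ x₂ y₁ y₂) [IsProbabilityMeasure μ]
    {τ1 τ2 : ℝ → ℝ} {q : ℝ}
    (hq : 0 ≤ q) (h1 : EX (fun δ => DD (Measure.map Prod.fst μ) (cell1 δ) q) (τ1 q))
    (h2 : EX (fun δ => DD (Measure.map Prod.snd μ) (cell1 δ) q) (τ2 q)) (Λ : ℝ) {ε : ℝ}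
    (hε : 0 < ε) : ∃ C : ℝ, 0 < C ∧ ∀ (w : List ι) (r : ℝ), 0 < r → r ≤ Λ →
      ENNReal.ofReal (C⁻¹ * r ^ (ε - tauW B τ1 τ2 w q)) ≤
        DD (Measure.map (B.projW w) μ) (cell1 r) q ∧
      DD (Measure.map (B.projW w) μ) (cell1 r) q ≤
        ENNReal.ofReal (C * r ^ (-ε - tauW B τ1 τ2 w q)) := by
  have i1 : IsProbabilityMeasure (Measure.map Prod.fst μ) :=
    Measure.isProbabilityMeasure_map measurable_fst.aemeasurable
  have i2 : IsProbabilityMeasure (Measure.map Prod.snd μ) :=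
    Measure.isProbabilityMeasure_map measurable_snd.aemeasurable
  obtain ⟨C1, hC1, b1⟩ := proj_all _ G.supp1 hq h1 Λ hε
  obtain ⟨C2, hC2, b2⟩ := proj_all _ G.supp2 hq h2 Λ hε
  refine ⟨C1 + C2, by positivity, fun w r h0 h => ?_⟩
  unfold IFSData.projW tauW
  split_ifs
  · obtain ⟨l, u⟩ := b1 r h0 h
    have := Real.rpow_pos_of_pos h0 (ε - τ1 q)
    have := Real.rpow_pos_of_pos h0 (-ε - τ1 q)
    refine ⟨le_trans (ENNReal.ofReal_le_ofReal ?_) l, u.trans (ENNReal.ofReal_le_ofReal ?_)⟩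
    · gcongr; linarith
    · gcongr; linarith
  · obtain ⟨l, u⟩ := b2 r h0 h
    have := Real.rpow_pos_of_pos h0 (ε - τ2 q)
    have := Real.rpow_pos_of_pos h0 (-ε - τ2 q)
    refine ⟨le_trans (ENNReal.ofReal_le_ofReal ?_) l, u.trans (ENNReal.ofReal_le_ofReal ?_)⟩
    · gcongr; linarith
    · gcongr; linarith

lemma term_upper {X C K δ a b m ε τ s : ℝ} (hX : 0 ≤ X) (hC : 0 < C) (hδ : 0 < δ) (ha : 0 < a)
    (ha1 : a ≤ 1) (hb : 0 < b) (hm : m * δ ≤ b) (hb1 : b ≤ δ) (hε : 0 < ε)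
    (hK : ∀ r, m ≤ r → r ≤ 1 → r ^ (-(s - τ)) ≤ K) :
    X * (C * (δ / a) ^ (-ε - τ)) ≤ C * K * δ ^ (-ε - s) * (X * a ^ τ * b ^ (s - τ)) := by
  have h1 := hK (b / δ) (by rwa [le_div_iff₀ hδ]) (by rwa [div_le_one hδ])
  have hbp : 0 < b ^ (s - τ) := Real.rpow_pos_of_pos hb _
  have e1 : (b / δ) ^ (-(s - τ)) = (b ^ (s - τ))⁻¹ * δ ^ (s - τ) := by
    rw [Real.rpow_neg (by positivity), Real.div_rpow hb.le hδ.le, inv_div, div_eq_inv_mul]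
  rw [e1] at h1
  have h2 : δ ^ (s - τ) ≤ K * b ^ (s - τ) := by
    rwa [inv_mul_eq_div, div_le_iff₀ hbp] at h1
  have e2 : (δ / a) ^ (-ε - τ) = δ ^ (-ε - s) * δ ^ (s - τ) * (a ^ ε * a ^ τ) := by
    rw [Real.div_rpow hδ.le ha.le, ← Real.rpow_add hδ, ← Real.rpow_add ha,
      show -ε - τ = -(ε + τ) by ring, Real.rpow_neg ha.le, div_inv_eq_mul]
    congr 2; ring
  have h3 : a ^ ε ≤ 1 := Real.rpow_le_one ha.le ha1 hε.le
  have p1 : 0 < a ^ ε := by positivity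
  have p2 : 0 < a ^ τ := by positivity
  have p3 : 0 < δ ^ (-ε - s) := by positivity
  have p4 : 0 < δ ^ (s - τ) := by positivity
  have p5 : 0 < K * b ^ (s - τ) := p4.trans_le h2
  rw [e2]
  calc X * (C * (δ ^ (-ε - s) * δ ^ (s - τ) * (a ^ ε * a ^ τ)))
      ≤ X * (C * (δ ^ (-ε - s) * (K * b ^ (s - τ)) * (1 * a ^ τ))) := by gcongr
    _ = _ := by ring

lemma term_lower {X C K δ a b m ε τ s : ℝ} (hX : 0 ≤ X) (hC : 0 < C) (hK0 : 0 < K)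
    (hδ : 0 < δ) (ha : 0 < a)
    (ha1 : a ≤ 1) (hb : 0 < b) (hm : m * δ ≤ b) (hb1 : b ≤ δ) (hε : 0 < ε)
    (hK : ∀ r, m ≤ r → r ≤ 1 → r ^ (s - τ) ≤ K) :
    C⁻¹ * K⁻¹ * δ ^ (ε - s) * (X * a ^ τ * b ^ (s - τ)) ≤ X * (C⁻¹ * (δ / a) ^ (ε - τ)) := by
  have h1 := hK (b / δ) (by rwa [le_div_iff₀ hδ]) (by rwa [div_le_one hδ])
  have p4 : 0 < δ ^ (s - τ) := by positivity
  have h2 : b ^ (s - τ) ≤ K * δ ^ (s - τ) := by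
    rwa [Real.div_rpow hb.le hδ.le, div_le_iff₀ p4] at h1
  have e2 : (δ / a) ^ (ε - τ) = δ ^ (ε - s) * δ ^ (s - τ) * (a ^ (-ε) * a ^ τ) := by
    rw [Real.div_rpow hδ.le ha.le, ← Real.rpow_add hδ, ← Real.rpow_add ha,
      show -ε + τ = -(ε - τ) by ring, Real.rpow_neg ha.le, ← div_eq_mul_inv]
    congr 2; ring
  have h3 : 1 ≤ a ^ (-ε) :=
    Real.one_le_rpow_of_pos_of_le_one_of_nonpos ha ha1 (neg_nonpos.2 hε.le)
  have p2 : 0 < a ^ τ := by positivity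
  have p3 : 0 < δ ^ (ε - s) := by positivity
  rw [e2]
  calc C⁻¹ * K⁻¹ * δ ^ (ε - s) * (X * a ^ τ * b ^ (s - τ))
      ≤ C⁻¹ * K⁻¹ * δ ^ (ε - s) * (X * a ^ τ * (K * δ ^ (s - τ))) := by gcongr
    _ = X * (C⁻¹ * (δ ^ (ε - s) * δ ^ (s - τ) * (1 * a ^ τ))) := by field_simp
    _ ≤ _ := by gcongr

lemma Good.cut_good (G : Good B p μ m M pm x₁ x₂ y₁ y₂) {δ : ℝ} (h0 : 0 < δ) (h1 : δ < 1) :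
    ∃ n : ℕ, ∀ w ∈ cut (fun l => B.alpha2 l < δ) n [], m * δ ≤ B.alpha2 w ∧ B.alpha2 w < δ := by
  obtain ⟨n, hn⟩ := exists_pow_lt_of_lt_one h0 G.M1
  have hst : ∀ l : List ι, n ≤ l.length → B.alpha2 l < δ := by
    intro l hl
    have h2 := (dims_le_pow G.hc G.hd G.cM G.dM l).1
    have h3 : M ^ l.length ≤ M ^ n := pow_le_pow_of_le_one G.M0.le G.M1.le hl
    exact (min_le_left _ _).trans_lt (by linarith)
  refine ⟨n, fun w hw => ?_⟩
  have hw2 : B.alpha2 w < δ := cut_halt (st := fun l => B.alpha2 l < δ) hst (by simp) hw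
  refine ⟨?_, hw2⟩
  have hne : w ≠ [] := by
    rintro rfl
    simp [IFSData.alpha2, dims_nil] at hw2
    linarith
  have h4 : δ ≤ B.alpha2 w.dropLast := by
    rcases cut_dropLast hw with h | h
    · exact absurd h hne
    · exact not_lt.1 h
  have h5 := alpha2_append_singleton G.m0 G.cm G.dm w.dropLast (w.getLast hne)
  rw [List.dropLast_append_getLast hne] at h5
  exact (mul_le_mul_of_nonneg_left h4 G.m0.le).trans h5

lemma Good.main_EX (G : Good B p μ m M pm x₁ x₂ y₁ y₂) [IsProbabilityMeasure μ]
    {τ1 τ2 : ℝ → ℝ} {q : ℝ}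
    (hq : 0 ≤ q) (h1 : EX (fun δ => DD (Measure.map Prod.fst μ) (cell1 δ) q) (τ1 q))
    (h2 : EX (fun δ => DD (Measure.map Prod.snd μ) (cell1 δ) q) (τ2 q))
    {P : ℝ → ℝ} (hP : ∀ s : ℝ,
      Tendsto (fun k : ℕ => PsiSV B p τ1 τ2 k s q ^ ((k : ℝ)⁻¹)) atTop (nhds (P s)))
    {γ : ℝ} (hγ : P γ = 1) : EX (fun δ => DD μ (cell2 δ) q) γ := by
  have HS := G.HS hq h1 h2
  intro e he
  set ε := e / 2 with hε'
  have hε : 0 < ε := by linarith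
  obtain ⟨C, hC, bC⟩ := G.proj_word hq h1 h2 (1 / m) hε
  obtain ⟨K1, K2, hcmp⟩ := G.compare
  have up : P (γ + ε) < 1 := by
    have h := P_mono G.hc G.hd G.M0 G.cM G.dM G.hp (by linarith) (hP γ) (hP (γ + ε))
    rw [hγ, mul_one] at h
    exact h.trans_lt (Real.rpow_lt_one G.M0.le G.M1 (by linarith))
  have lo : 1 < P (γ - ε) := by
    have h := P_mono G.hc G.hd G.M0 G.cM G.dM G.hp (by linarith) (hP (γ - ε)) (hP γ)
    rw [hγ] at h
    have h3 : M ^ (γ - (γ - ε)) < 1 := Real.rpow_lt_one G.M0.le G.M1 (by linarith)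
    have h4 : 0 < M ^ (γ - (γ - ε)) := Real.rpow_pos_of_pos G.M0 _
    nlinarith
  obtain ⟨U, hU, bU⟩ := cut_upper G.hc G.hd G.hp (hP (γ + ε)) up
  obtain ⟨V, hV, bV⟩ := cut_lower G.hc G.hd G.hp HS (hP (γ - ε)) lo
  have bdd : ∀ f : ℝ → ℝ, ∃ K : ℝ, 0 < K ∧ ∀ w : List ι, ∀ r, m ≤ r → r ≤ 1 →
      r ^ (f (tauW B τ1 τ2 w q)) ≤ K := by
    intro f
    obtain ⟨Ka, hKa, ba⟩ := rpow_bdd (a := m) (b := 1) G.m0 (f (τ1 q))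
    obtain ⟨Kb, hKb, bb⟩ := rpow_bdd (a := m) (b := 1) G.m0 (f (τ2 q))
    refine ⟨Ka + Kb, by positivity, fun w r hr hr' => ?_⟩
    unfold tauW
    split_ifs
    · linarith [ba r hr hr']
    · linarith [bb r hr hr']
  obtain ⟨Ku, hKu, bKu⟩ := bdd (fun t => -(γ + ε - t))
  obtain ⟨Kl, hKl, bKl⟩ := bdd (fun t => γ - ε - t)
  set Au : ℝ := (K1 : ℝ) ^ q * K2 * (C * Ku * U) with hAu
  set Al : ℝ := (K2 : ℝ) ^ q * K1 with hAl
  have hAu0 : 0 ≤ Au := by positivity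
  have hAl0 : 0 ≤ Al := by positivity
  refine ⟨(Au + 1) + (Al + 1) * (C * Kl * V⁻¹), by positivity, ?_⟩
  filter_upwards [small_pos] with δ hδ
  obtain ⟨h0, h1'⟩ := hδ
  obtain ⟨n, hn⟩ := G.cut_good h0 h1'
  obtain ⟨cu, cl⟩ := hcmp δ h0 _ n hn q hq
  set W := cut (fun l => B.alpha2 l < δ) n [] with hW
  have a1 : ∀ w, 0 < B.alpha1 w := fun w => lt_max_of_lt_left (dims_pos G.hc G.hd w).1
  have a11 : ∀ w, B.alpha1 w ≤ 1 := fun w => by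
    have h := dims_le_pow G.hc G.hd G.cM G.dM w
    have h' : M ^ w.length ≤ 1 := pow_le_one₀ G.M0.le G.M1.le
    exact max_le (h.1.trans h') (h.2.trans h')
  have a2 : ∀ w, 0 < B.alpha2 w := fun w => lt_min (dims_pos G.hc G.hd w).1 (dims_pos G.hc G.hd w).2
  have a21 : ∀ w, B.alpha2 w ≤ B.alpha1 w := fun w => min_le_max
  have hr : ∀ w ∈ W, δ / B.alpha1 w ≤ 1 / m := by
    intro w hw
    rw [div_le_div_iff₀ (a1 w) G.m0, one_mul, mul_comm]
    exact (hn w hw).1.trans (a21 w)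
  have hpw : ∀ w, 0 < wordProb p w := fun w => wordProb_pos G.hp w
  have hGG : ∀ w, GG q (ENNReal.ofReal (wordProb p w)) = ENNReal.ofReal (wordProb p w ^ q) := by
    intro w
    rw [GG_eq (by simpa using hpw w) ENNReal.ofReal_ne_top, ENNReal.ofReal_rpow_of_pos (hpw w)]
  have hX : ∀ w, 0 < wordProb p w ^ q := fun w => Real.rpow_pos_of_pos (hpw w) q
  set T : ENNReal := ∑ w ∈ W, GG q (ENNReal.ofReal (wordProb p w)) *
        DD (Measure.map (B.projW w) μ) (cell1 (δ / B.alpha1 w)) q with hT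
  have hpsi : ∀ s w, 0 < psiSV B p τ1 τ2 s q w := fun s w => psi_pos G.hc G.hd G.hp τ1 τ2 s q w
  have Tu : T ≤ ENNReal.ofReal (C * Ku * δ ^ (-ε - (γ + ε)) * U) := by
    have : T ≤ ∑ w ∈ W, ENNReal.ofReal (C * Ku * δ ^ (-ε - (γ + ε)) *
        psiSV B p τ1 τ2 (γ + ε) q w) := by
      refine Finset.sum_le_sum fun w hw => ?_
      have h3 := (bC w _ (div_pos h0 (a1 w)) (hr w hw)).2
      rw [hGG]
      calc _ ≤ ENNReal.ofReal (wordProb p w ^ q) * _ := mul_le_mul_right h3 _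
        _ = _ := (ENNReal.ofReal_mul (hX w).le).symm
        _ ≤ _ := ENNReal.ofReal_le_ofReal
          (term_upper (hX w).le hC h0 (a1 w) (a11 w) (a2 w) (hn w hw).1 (hn w hw).2.le hε (bKu w))
    refine this.trans ?_
    rw [← ENNReal.ofReal_sum_of_nonneg (fun w _ => by have := hpsi (γ + ε) w; positivity),
      ← Finset.mul_sum]
    refine ENNReal.ofReal_le_ofReal ?_
    have := bU (fun l => B.alpha2 l < δ) n
    gcongr
  have Tl : ENNReal.ofReal (C⁻¹ * Kl⁻¹ * δ ^ (ε - (γ - ε)) * V) ≤ T := by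
    have : ∑ w ∈ W, ENNReal.ofReal (C⁻¹ * Kl⁻¹ * δ ^ (ε - (γ - ε)) *
        psiSV B p τ1 τ2 (γ - ε) q w) ≤ T := by
      refine Finset.sum_le_sum fun w hw => ?_
      have h3 := (bC w _ (div_pos h0 (a1 w)) (hr w hw)).1
      rw [hGG]
      refine (ENNReal.ofReal_le_ofReal (term_lower (hX w).le hC hKl h0 (a1 w) (a11 w) (a2 w)
        (hn w hw).1 (hn w hw).2.le hε (bKl w))).trans ?_
      rw [ENNReal.ofReal_mul (hX w).le]
      exact mul_le_mul_right h3 _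
    refine le_trans ?_ this
    rw [← ENNReal.ofReal_sum_of_nonneg (fun w _ => by have := hpsi (γ - ε) w; positivity),
      ← Finset.mul_sum]
    refine ENNReal.ofReal_le_ofReal ?_
    have := bV (fun l => B.alpha2 l < δ) n
    gcongr
  have eu : -ε - (γ + ε) = -e - γ := by rw [hε']; ring
  have el : ε - (γ - ε) = e - γ := by rw [hε']; ring
  rw [eu] at Tu
  rw [el] at Tl
  have p1 : 0 < δ ^ (-e - γ) := Real.rpow_pos_of_pos h0 _
  have p2 : 0 < δ ^ (e - γ) := Real.rpow_pos_of_pos h0 _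
  constructor
  · have h5 : ENNReal.ofReal (C⁻¹ * Kl⁻¹ * δ ^ (e - γ) * V) ≤
        ENNReal.ofReal (Al + 1) * DD μ (cell2 δ) q := by
      refine (Tl.trans cl).trans ?_
      gcongr
      rw [natCast_rpow_ofReal _ hq, ← ENNReal.ofReal_natCast K1, ← ENNReal.ofReal_mul (by positivity)]
      exact ENNReal.ofReal_le_ofReal (by linarith)
    refine le_trans (ENNReal.ofReal_le_ofReal ?_) (ofReal_div_le (by positivity) h5)
    have e5 : C⁻¹ * Kl⁻¹ * δ ^ (e - γ) * V / (Al + 1) =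
        ((Al + 1) * (C * Kl * V⁻¹))⁻¹ * δ ^ (e - γ) := by field_simp
    rw [e5]
    gcongr
    linarith
  · refine cu.trans ?_
    calc _ ≤ (K1 : ENNReal) ^ q * K2 * ENNReal.ofReal (C * Ku * δ ^ (-e - γ) * U) := by gcongr
      _ = ENNReal.ofReal (Au * δ ^ (-e - γ)) := by
        rw [natCast_rpow_ofReal _ hq, ← ENNReal.ofReal_natCast K2,
          ← ENNReal.ofReal_mul (by positivity), ← ENNReal.ofReal_mul (by positivity)]
        congr 1; rw [hAu]; ring
      _ ≤ _ := by
        refine ENNReal.ofReal_le_ofReal ?_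
        gcongr
        have : 0 < (Al + 1) * (C * Kl * V⁻¹) := by positivity
        linarith

end final

theorem lq_spectrum_eq_gamma_of_ROSC
    {ι : Type} [Fintype ι] [Nonempty ι] (hcard : 2 ≤ Fintype.card ι)
    (B : IFSData ι)
    (hc : ∀ i, B.c i ∈ Set.Ioo (0 : ℝ) 1) (hd : ∀ i, B.d i ∈ Set.Ioo (0 : ℝ) 1)
    (p : ι → ℝ) (hp : ∀ i, p i ∈ Set.Ioo (0 : ℝ) 1) (hpsum : ∑ i : ι, p i = 1)
    (μ : Measure (ℝ × ℝ)) [IsProbabilityMeasure μ]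
    (hcpt : ∃ K : Set (ℝ × ℝ), IsCompact K ∧ μ Kᶜ = 0)
    (hself : μ = ∑ i : ι, ENNReal.ofReal (p i) • Measure.map (B.S i) μ)
    (τ1 τ2 : ℝ → ℝ)
    (hτ1 : ∀ q : ℝ, 0 ≤ q → IsLqSpec (Measure.map Prod.fst μ) q (τ1 q))
    (hτ2 : ∀ q : ℝ, 0 ≤ q → IsLqSpec (Measure.map Prod.snd μ) q (τ2 q))
    (P : ℝ → ℝ → ℝ)
    (hP : ∀ s q : ℝ, 0 ≤ q →
      Tendsto (fun k : ℕ => PsiSV B p τ1 τ2 k s q ^ ((k : ℝ)⁻¹)) atTop (nhds (P s q)))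
    (γ : ℝ → ℝ) (hγ : ∀ q : ℝ, 0 ≤ q → P (γ q) q = 1)
    (hROSC : B.ROSC)
     :
    ∀ q : ℝ, 0 ≤ q → lowerLq μ q = γ q ∧ upperLq μ q = γ q := by
  intro q hq
  obtain ⟨x₁, x₂, y₁, y₂, hx, hy, hsub, hdisj⟩ := hROSC
  have hm : ∀ i, alphaMin B ≤ min (B.c i) (B.d i) := fun i =>
    Finset.inf'_le (fun i => min (B.c i) (B.d i)) (Finset.mem_univ i)
  have hM : ∀ i, max (B.c i) (B.d i) ≤ alphaMax B := fun i =>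
    Finset.le_sup' (fun i => max (B.c i) (B.d i)) (Finset.mem_univ i)
  have hm0 : 0 < alphaMin B :=
    (Finset.lt_inf'_iff _).2 fun i _ => lt_min (hc i).1 (hd i).1
  have hM1 : alphaMax B < 1 :=
    (Finset.sup'_lt_iff _).2 fun i _ => max_lt (hc i).2 (hd i).2
  set pm := Finset.univ.inf' Finset.univ_nonempty p with hpm
  have hpm0 : 0 < pm := (Finset.lt_inf'_iff _).2 fun i _ => (hp i).1
  have hpmp : ∀ i, pm ≤ p i := fun i => Finset.inf'_le p (Finset.mem_univ i)
  obtain ⟨i0⟩ := ‹Nonempty ι›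
  have hcM : ∀ i, B.c i ≤ alphaMax B := fun i => (le_max_left _ _).trans (hM i)
  have hdM : ∀ i, B.d i ≤ alphaMax B := fun i => (le_max_right _ _).trans (hM i)
  have hcm : ∀ i, alphaMin B ≤ B.c i := fun i => (hm i).trans (min_le_left _ _)
  have hdm : ∀ i, alphaMin B ≤ B.d i := fun i => (hm i).trans (min_le_right _ _)
  have hM0 : 0 < alphaMax B := (hc i0).1.trans_le (hcM i0)
  have G : Good B p μ (alphaMin B) (alphaMax B) pm x₁ x₂ y₁ y₂ :=
    { m0 := hm0
      M1 := hM1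
      cm := hcm
      dm := hdm
      cM := hcM
      dM := hdM
      M0 := hM0
      m1 := (hcm i0).trans (hc i0).2.le
      pm0 := hpm0
      pm1 := (hpmp i0).trans_lt (hp i0).2
      pmp := hpmp
      psum := hpsum
      self := hself
      hx := hx
      hy := hy
      sub := hsub
      disj := hdisj
      supp := supp_Rc (fun i => (hc i).1) (fun i => (hd i).1) hM0 hM1 hcM hdM (fun i => (hp i).1)
        hpsum hcpt hself hx hy hsub }
  have i1 : IsProbabilityMeasure (Measure.map Prod.fst μ) :=
    Measure.isProbabilityMeasure_map measurable_fst.aemeasurable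
  have i2 : IsProbabilityMeasure (Measure.map Prod.snd μ) :=
    Measure.isProbabilityMeasure_map measurable_snd.aemeasurable
  have h1 := proj_EX _ G.supp1 hx (PolyLow_map G.polyLow Prod.fst measurable_fst
    (fun x y => le_max_left _ _)) hq (hτ1 q hq)
  have h2 := proj_EX _ G.supp2 hy (PolyLow_map G.polyLow Prod.snd measurable_snd
    (fun x y => le_max_right _ _)) hq (hτ2 q hq)
  have h := G.main_EX (P := fun s => P s q) hq h1 h2 (fun s => hP s q hq) (hγ q hq)
  obtain ⟨e1, e2⟩ := cell2_equiv μ G.polyLow hq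
  exact EX_to_spec μ G.polyLow (EX_congr e2 e1 h)
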